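/- Let r>0 and let F(r) ⊂ ℝ³ be the union of the 12 closed triangles with vertex triples (A,B,c), (A,B,d), (A,C,b), (A,C,d), (A,D,b), (A,D,c), (B,C,a), (B,C,d), (B,D,a), (B,D,c), (C,D,a), (C,D,b), where A=(1,-1,-1), B=(-1,1,-1), C=(-1,-1,1), D=(1,1,1), a=(r/3)(-1,1,1), b=(r/3)(1,-1,1), c=(r/3)(1,1,-1), d=(r/3)(-1,-1,-1). Let μ be the 2-dimensional Hausdorff measure restricted to F(r). A continuous function f:ℝ³→ℝ satisfies f(x) = (1/μ(F(r)))·∫_{F(r)} f(x+s·y) dμ(y) for all x∈ℝ³ and all s>0 if and only if: (when r=3) f coincides with the function of a polynomial p∈ℝ[x₁,x₂,x₃] satisfying e₂(∂)p = e₄(∂)p = e₆(∂)p = 0; and (when r≠3) f coincides with the function of a polynomial p satisfying e₂(∂)p = e₃(∂)p = e₄(∂)p = 0. -/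

import Mathlib

open MvPolynomial MeasureTheory

noncomputable def dop (φ : MvPolynomial (Fin 3) ℝ) :
    MvPolynomial (Fin 3) ℝ →ₗ[ℝ] MvPolynomial (Fin 3) ℝ :=
  φ.support.sum fun s => φ.coeff s •
    (((pderiv (0 : Fin 3)).toLinearMap ^ s 0) *
     ((pderiv (1 : Fin 3)).toLinearMap ^ s 1) *
     ((pderiv (2 : Fin 3)).toLinearMap ^ s 2))

noncomputable def e2 : MvPolynomial (Fin 3) ℝ := X 0 ^ 2 + X 1 ^ 2 + X 2 ^ 2
noncomputable def e3 : MvPolynomial (Fin 3) ℝ := X 0 * X 1 * X 2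
noncomputable def e4 : MvPolynomial (Fin 3) ℝ :=
  X 1 ^ 2 * X 2 ^ 2 + X 2 ^ 2 * X 0 ^ 2 + X 0 ^ 2 * X 1 ^ 2
noncomputable def e6 : MvPolynomial (Fin 3) ℝ := X 0 ^ 2 * X 1 ^ 2 * X 2 ^ 2

noncomputable abbrev E3 := EuclideanSpace ℝ (Fin 3)

noncomputable def toFn (x : E3) : Fin 3 → ℝ := (WithLp.equiv 2 (Fin 3 → ℝ)) x

noncomputable def pt (u : Fin 3 → ℝ) : E3 := (WithLp.equiv 2 (Fin 3 → ℝ)).symm u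

/-- Vertices of the regular tetrahedron. -/
noncomputable def vA : E3 := pt ![1, -1, -1]
noncomputable def vB : E3 := pt ![-1, 1, -1]
noncomputable def vC : E3 := pt ![-1, -1, 1]
noncomputable def vD : E3 := pt ![1, 1, 1]

/-- Apex vertices of the isohedral triakis tetrahedron with parameter `r`. -/
noncomputable def va (r : ℝ) : E3 := pt ((r / 3) • ![-1, 1, 1])
noncomputable def vb (r : ℝ) : E3 := pt ((r / 3) • ![1, -1, 1])
noncomputable def vc (r : ℝ) : E3 := pt ((r / 3) • ![1, 1, -1])
noncomputable def vd (r : ℝ) : E3 := pt ((r / 3) • ![-1, -1, -1])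

/-- The 2-skeleton (union of the 12 triangular faces) of the isohedral triakis
tetrahedron with parameter `r`. -/
noncomputable def faceSet (r : ℝ) : Set E3 :=
  convexHull ℝ {vA, vB, vc r} ∪ convexHull ℝ {vA, vB, vd r} ∪
  convexHull ℝ {vA, vC, vb r} ∪ convexHull ℝ {vA, vC, vd r} ∪
  convexHull ℝ {vA, vD, vb r} ∪ convexHull ℝ {vA, vD, vc r} ∪
  convexHull ℝ {vB, vC, va r} ∪ convexHull ℝ {vB, vC, vd r} ∪
  convexHull ℝ {vB, vD, va r} ∪ convexHull ℝ {vB, vD, vc r} ∪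
  convexHull ℝ {vC, vD, va r} ∪ convexHull ℝ {vC, vD, vb r}

section ConstantCoefficientOperators

variable {V W : Type*} [AddCommGroup V] [Module ℝ V] [AddCommGroup W] [Module ℝ W]

/-- The monomial `D₀^{s₀} D₁^{s₁} D₂^{s₂}` in three endomorphisms. -/
noncomputable def opMonomial (D : Fin 3 → Module.End ℝ V) (s : Fin 3 →₀ ℕ) : Module.End ℝ V :=
  D 0 ^ s 0 * D 1 ^ s 1 * D 2 ^ s 2

lemma opMonomial_add {D : Fin 3 → Module.End ℝ V} (hD : ∀ i j, Commute (D i) (D j))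
    (s t : Fin 3 →₀ ℕ) : opMonomial D (s + t) = opMonomial D s * opMonomial D t := by
  have h01 : Commute (D 1 ^ s 1) (D 0 ^ t 0) := (hD 1 0).pow_pow _ _
  have h02 : Commute (D 2 ^ s 2) (D 0 ^ t 0) := (hD 2 0).pow_pow _ _
  have h12 : Commute (D 2 ^ s 2) (D 1 ^ t 1) := (hD 2 1).pow_pow _ _
  simp only [opMonomial, Finsupp.add_apply, pow_add]
  calc _ = D 0 ^ s 0 * (D 0 ^ t 0 * D 1 ^ s 1) * (D 1 ^ t 1 * D 2 ^ s 2) * D 2 ^ t 2 := by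
        simp only [mul_assoc]
    _ = D 0 ^ s 0 * (D 1 ^ s 1 * D 0 ^ t 0) * (D 2 ^ s 2 * D 1 ^ t 1) * D 2 ^ t 2 := by
        rw [h01.eq, h12.eq]
    _ = D 0 ^ s 0 * D 1 ^ s 1 * (D 0 ^ t 0 * D 2 ^ s 2) * D 1 ^ t 1 * D 2 ^ t 2 := by
        simp only [mul_assoc]
    _ = _ := by rw [← h02.eq]; simp only [mul_assoc]

/-- Evaluation of a polynomial at three commuting endomorphisms. -/
noncomputable def opHom (D : Fin 3 → Module.End ℝ V) (hD : ∀ i j, Commute (D i) (D j)) :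
    MvPolynomial (Fin 3) ℝ →ₐ[ℝ] Module.End ℝ V :=
  AddMonoidAlgebra.lift ℝ (Module.End ℝ V) (Fin 3 →₀ ℕ)
    { toFun := fun s => opMonomial D s.toAdd
      map_one' := by simp [opMonomial]
      map_mul' := fun s t => opMonomial_add hD _ _ }

lemma opHom_apply (D : Fin 3 → Module.End ℝ V) (hD : ∀ i j, Commute (D i) (D j))
    (φ : MvPolynomial (Fin 3) ℝ) :
    opHom D hD φ = φ.support.sum fun s => φ.coeff s • opMonomial D s :=
  AddMonoidAlgebra.lift_apply _ _

lemma opHom_X (D : Fin 3 → Module.End ℝ V) (hD : ∀ i j, Commute (D i) (D j)) (i : Fin 3) :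
    opHom D hD (X i) = D i := by
  have : opHom D hD (X i) = opMonomial D (Finsupp.single i 1) := by
    refine (AddMonoidAlgebra.lift_single _ _ _).trans ?_
    simp
  rw [this]
  fin_cases i <;> simp [opMonomial]

lemma opHom_intertwine {D : Fin 3 → Module.End ℝ V} {hD : ∀ i j, Commute (D i) (D j)}
    {D' : Fin 3 → Module.End ℝ W} {hD' : ∀ i j, Commute (D' i) (D' j)} (T : V →ₗ[ℝ] W)
    (hT : ∀ i v, T (D i v) = D' i (T v)) (φ : MvPolynomial (Fin 3) ℝ) (v : V) :
    T (opHom D hD φ v) = opHom D' hD' φ (T v) := by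
  induction φ using MvPolynomial.induction_on generalizing v with
  | C a => simp [← algebraMap_eq]
  | add p q hp hq => simp [hp, hq]
  | mul_X p i hp => simp [opHom_X, hp, hT]

/-- The ideal of polynomials whose associated operator annihilates `v`. -/
noncomputable def opAnnihilator (D : Fin 3 → Module.End ℝ V) (hD : ∀ i j, Commute (D i) (D j))
    (v : V) : Ideal (MvPolynomial (Fin 3) ℝ) where
  carrier := {φ | opHom D hD φ v = 0}
  add_mem' := by intro a b ha hb; simp_all
  zero_mem' := by simp
  smul_mem' := by intro c φ h; simp_all

end ConstantCoefficientOperators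

lemma pderiv_commute (i j : Fin 3) :
    Commute (pderiv (R := ℝ) i).toLinearMap (pderiv (R := ℝ) j).toLinearMap := by
  refine LinearMap.ext fun p => ?_
  have h : ⁅pderiv (R := ℝ) i, pderiv (R := ℝ) j⁆ = 0 := by
    refine MvPolynomial.derivation_ext fun k => ?_
    simp [Derivation.commutator_apply, pderiv_X, Pi.single_apply, apply_ite]
  have := congrArg (fun d => d p) h
  simpa [Derivation.commutator_apply, sub_eq_zero] using this

lemma dop_eq_opHom (φ : MvPolynomial (Fin 3) ℝ) :
    dop φ = opHom (fun i => (pderiv i).toLinearMap) pderiv_commute φ := by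
  simp only [dop, opHom_apply, opMonomial]

section TetrahedralIdeal

lemma sum_perm_fin_three {M : Type*} [AddCommMonoid M] (F : Equiv.Perm (Fin 3) → M) :
    ∑ σ, F σ = F 1 + F (Equiv.swap 0 1) + F (Equiv.swap 0 2) + F (Equiv.swap 1 2) +
      F (Equiv.swap 0 1 * Equiv.swap 1 2) + F (Equiv.swap 1 2 * Equiv.swap 0 1) := by
  have h : (Finset.univ : Finset (Equiv.Perm (Fin 3))) = {1, Equiv.swap 0 1, Equiv.swap 0 2,
      Equiv.swap 1 2, Equiv.swap 0 1 * Equiv.swap 1 2, Equiv.swap 1 2 * Equiv.swap 0 1} := by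
    decide
  rw [h]
  repeat rw [Finset.sum_insert (by decide)]
  rw [Finset.sum_singleton]
  simp only [add_assoc]

variable {I : Ideal (MvPolynomial (Fin 3) ℝ)}

lemma X_pow_six_mem (h2 : e2 ∈ I) (h4 : e4 ∈ I) (h6 : e6 ∈ I) (i : Fin 3) : X i ^ 6 ∈ I := by
  have h : (X i ^ 6 : MvPolynomial (Fin 3) ℝ) = X i ^ 4 * e2 - X i ^ 2 * e4 + e6 := by
    fin_cases i <;> simp only [e2, e4, e6] <;> simp <;> ring
  rw [h]
  exact I.add_mem (I.sub_mem (I.mul_mem_left _ h2) (I.mul_mem_left _ h4)) h6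

/-- Newton's identities for the power sums of the squares. -/
lemma even_power_sum_mem (h2 : e2 ∈ I) (h4 : e4 ∈ I) (h6 : e6 ∈ I) (k : ℕ) (hk : k ≠ 0) :
    X 0 ^ (2 * k) + X 1 ^ (2 * k) + X 2 ^ (2 * k) ∈ I := by
  induction k using Nat.strong_induction_on with
  | _ k ih =>
    match k, hk with
    | 1, _ => simpa [e2] using h2
    | 2, _ =>
      have h : (X 0 ^ (2 * 2) + X 1 ^ (2 * 2) + X 2 ^ (2 * 2) : MvPolynomial (Fin 3) ℝ) =
          e2 * e2 - 2 * e4 := by simp only [e2, e4]; ring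
      rw [h]
      exact I.sub_mem (I.mul_mem_left _ h2) (I.mul_mem_left _ h4)
    | n + 3, _ =>
      have h : (X 0 ^ (2 * (n + 3)) + X 1 ^ (2 * (n + 3)) + X 2 ^ (2 * (n + 3)) :
          MvPolynomial (Fin 3) ℝ) =
          (X 0 ^ (2 * (n + 2)) + X 1 ^ (2 * (n + 2)) + X 2 ^ (2 * (n + 2))) * e2 -
          (X 0 ^ (2 * (n + 1)) + X 1 ^ (2 * (n + 1)) + X 2 ^ (2 * (n + 1))) * e4 +
          (X 0 ^ (2 * n) + X 1 ^ (2 * n) + X 2 ^ (2 * n)) * e6 := by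
        simp only [e2, e4, e6]; ring
      rw [h]
      exact I.add_mem (I.sub_mem (I.mul_mem_left _ h2) (I.mul_mem_left _ h4)) (I.mul_mem_left _ h6)

lemma even_symmetric_sum_mem (h2 : e2 ∈ I) (h4 : e4 ∈ I) (h6 : e6 ∈ I) (α : Fin 3 → ℕ)
    (hα : ∀ i, Even (α i)) (h0 : α ≠ 0) :
    ∑ σ : Equiv.Perm (Fin 3), ∏ i, (X i : MvPolynomial (Fin 3) ℝ) ^ (α (σ i)) ∈ I := by
  have hp := even_power_sum_mem h2 h4 h6
  have key : ∀ a b : ℕ, a + b ≠ 0 →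
      (X 0 ^ (2 * a) * X 1 ^ (2 * b) + X 1 ^ (2 * a) * X 0 ^ (2 * b) +
        X 2 ^ (2 * a) * X 1 ^ (2 * b) + X 1 ^ (2 * a) * X 2 ^ (2 * b) +
        X 0 ^ (2 * a) * X 2 ^ (2 * b) + X 2 ^ (2 * a) * X 0 ^ (2 * b) :
        MvPolynomial (Fin 3) ℝ) ∈ I := by
    intro a b hab
    have h : (X 0 ^ (2 * a) * X 1 ^ (2 * b) + X 1 ^ (2 * a) * X 0 ^ (2 * b) +
        X 2 ^ (2 * a) * X 1 ^ (2 * b) + X 1 ^ (2 * a) * X 2 ^ (2 * b) +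
        X 0 ^ (2 * a) * X 2 ^ (2 * b) + X 2 ^ (2 * a) * X 0 ^ (2 * b) :
        MvPolynomial (Fin 3) ℝ) =
        (X 0 ^ (2 * a) + X 1 ^ (2 * a) + X 2 ^ (2 * a)) *
          (X 0 ^ (2 * b) + X 1 ^ (2 * b) + X 2 ^ (2 * b)) -
        (X 0 ^ (2 * (a + b)) + X 1 ^ (2 * (a + b)) + X 2 ^ (2 * (a + b))) := by ring
    rw [h]
    refine I.sub_mem ?_ (hp _ hab)
    by_cases ha : a = 0
    · exact I.mul_mem_left _ (hp _ (by omega))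
    · exact I.mul_mem_right _ (hp _ ha)
  obtain ⟨a, ha⟩ := (hα 0).two_dvd
  obtain ⟨b, hb⟩ := (hα 1).two_dvd
  obtain ⟨c, hc⟩ := (hα 2).two_dvd
  have hne : a + b + c ≠ 0 := by
    intro h
    refine h0 (funext fun i => ?_)
    fin_cases i
    · change α 0 = 0; omega
    · change α 1 = 0; omega
    · change α 2 = 0; omega
  rw [sum_perm_fin_three]
  simp only [Fin.prod_univ_three, Equiv.Perm.one_apply, Equiv.Perm.mul_apply, Equiv.swap_apply_left,
    Equiv.swap_apply_right, show Equiv.swap (0 : Fin 3) 1 2 = 2 by decide,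
    show Equiv.swap (0 : Fin 3) 2 1 = 1 by decide, show Equiv.swap (1 : Fin 3) 2 0 = 0 by decide,
    ha, hb, hc]
  rcases Nat.eq_zero_or_pos a with rfl | ha'
  · convert key b c (by omega) using 1; ring
  rcases Nat.eq_zero_or_pos b with rfl | hb'
  · convert key a c (by omega) using 1; ring
  rcases Nat.eq_zero_or_pos c with rfl | hc'
  · convert key a b (by omega) using 1; ring
  obtain ⟨a, rfl⟩ := Nat.exists_eq_succ_of_ne_zero ha'.ne'
  obtain ⟨b, rfl⟩ := Nat.exists_eq_succ_of_ne_zero hb'.ne'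
  obtain ⟨c, rfl⟩ := Nat.exists_eq_succ_of_ne_zero hc'.ne'
  have hT : ∀ a b c : ℕ, (X 0 ^ (2 * a.succ) * X 1 ^ (2 * b.succ) * X 2 ^ (2 * c.succ) :
      MvPolynomial (Fin 3) ℝ) ∈ I := by
    intro a b c
    have h : (X 0 ^ (2 * a.succ) * X 1 ^ (2 * b.succ) * X 2 ^ (2 * c.succ) :
        MvPolynomial (Fin 3) ℝ) = X 0 ^ (2 * a) * X 1 ^ (2 * b) * X 2 ^ (2 * c) * e6 := by
      simp only [e6, Nat.succ_eq_add_one]; ring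
    rw [h]
    exact I.mul_mem_left _ h6
  exact I.add_mem (I.add_mem (I.add_mem (I.add_mem (I.add_mem (hT _ _ _) (hT _ _ _)) (hT _ _ _))
    (hT _ _ _)) (hT _ _ _)) (hT _ _ _)

lemma odd_monomial_mem (h3 : e3 ∈ I) (α : Fin 3 → ℕ) (hα : ∀ i, Odd (α i)) :
    ∏ i, (X i : MvPolynomial (Fin 3) ℝ) ^ (α i) ∈ I := by
  have h : (e3 : MvPolynomial (Fin 3) ℝ) ∣ ∏ i, (X i : MvPolynomial (Fin 3) ℝ) ^ (α i) := by
    rw [Fin.prod_univ_three, e3]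
    exact mul_dvd_mul (mul_dvd_mul (dvd_pow_self _ (hα 0).pos.ne') (dvd_pow_self _ (hα 1).pos.ne'))
      (dvd_pow_self _ (hα 2).pos.ne')
  exact Ideal.mem_of_dvd _ h h3

/-- The formal pairing `y₀ X₀ + y₁ X₁ + y₂ X₂`. -/
noncomputable def linForm (y : E3) : MvPolynomial (Fin 3) ℝ := ∑ i, C (y i) * X i

lemma exists_linForm_pow_mem (h2 : e2 ∈ I) (h4 : e4 ∈ I) (h6 : e6 ∈ I) :
    ∃ N, ∀ y, linForm y ^ N ∈ I := by
  obtain ⟨N, hN⟩ := I.exists_radical_pow_le_of_fg (IsNoetherian.noetherian _)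
  refine ⟨N, fun y => hN (Ideal.pow_mem_pow ?_ N)⟩
  exact Ideal.sum_mem _ fun i _ => Ideal.mul_mem_left _ _ ⟨6, X_pow_six_mem h2 h4 h6 i⟩

lemma linForm_pow (y : E3) (k : ℕ) (l : MvPolynomial (Fin 3) ℝ →ₗ[ℝ] ℝ) :
    l (linForm y ^ k) = ∑ α ∈ Finset.univ.piAntidiag k,
      (Nat.multinomial Finset.univ α : ℝ) * (∏ i, y i ^ α i) * l (∏ i, X i ^ α i) := by
  rw [linForm, Finset.sum_pow_eq_sum_piAntidiag, map_sum]
  refine Finset.sum_congr rfl fun α _ => ?_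
  rw [← smul_eq_mul (_ * _), ← map_smul]
  congr 1
  rw [smul_eq_C_mul, C_mul, map_prod, map_natCast]
  simp only [mul_pow, Finset.prod_mul_distrib, C_pow, mul_assoc]

end TetrahedralIdeal

section TetrahedralMeasure

/-- Permutation of the coordinates. -/
noncomputable def permMap (σ : Equiv.Perm (Fin 3)) (y : E3) : E3 := pt fun j => y (σ j)

/-- Change of sign of all coordinates but the `i`-th. -/
noncomputable def signMap (i : Fin 3) (y : E3) : E3 := pt fun j => if j = i then y j else -y j

@[simp] lemma pt_apply (u : Fin 3 → ℝ) (i : Fin 3) : pt u i = u i := rfl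

@[simp] lemma permMap_apply (σ : Equiv.Perm (Fin 3)) (y : E3) (j : Fin 3) :
    permMap σ y j = y (σ j) := rfl

@[simp] lemma signMap_apply (i : Fin 3) (y : E3) (j : Fin 3) :
    signMap i y j = if j = i then y j else -y j := rfl

lemma continuous_pt {T : Type*} [TopologicalSpace T] {u : T → Fin 3 → ℝ}
    (hu : ∀ i, Continuous fun t => u t i) : Continuous fun t => pt (u t) :=
  (PiLp.continuous_toLp 2 _).comp (continuous_pi hu)

lemma continuous_permMap (σ : Equiv.Perm (Fin 3)) : Continuous (permMap σ) :=
  continuous_pt fun i => by fun_prop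

lemma continuous_signMap (i : Fin 3) : Continuous (signMap i) :=
  continuous_pt fun j => by by_cases h : j = i <;> simp only [h, if_true, if_false] <;> fun_prop

/-- Measures integrating continuous functions and invariant under the tetrahedral group. -/
structure IsTetrahedral (τ : Measure E3) : Prop where
  integrable : ∀ h : E3 → ℝ, Continuous h → Integrable h τ
  perm : ∀ σ (h : E3 → ℝ), Continuous h → ∫ y, h (permMap σ y) ∂τ = ∫ y, h y ∂τ
  sign : ∀ i (h : E3 → ℝ), Continuous h → ∫ y, h (signMap i y) ∂τ = ∫ y, h y ∂τ

lemma continuous_linForm_pow (l : MvPolynomial (Fin 3) ℝ →ₗ[ℝ] ℝ) (k : ℕ) :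
    Continuous fun y => l (linForm y ^ k) := by
  simp only [linForm_pow]
  fun_prop

/-- The average of `h` over the tetrahedral group. -/
noncomputable def tetraAvg (h : E3 → ℝ) (y : E3) : ℝ :=
  (∑ σ : Equiv.Perm (Fin 3), (h (permMap σ y) + ∑ i, h (permMap σ (signMap i y)))) / 24

variable {τ : Measure E3}

lemma IsTetrahedral.integral_tetraAvg (hτ : IsTetrahedral τ) {h : E3 → ℝ} (hh : Continuous h) :
    ∫ y, tetraAvg h y ∂τ = ∫ y, h y ∂τ := by
  have c1 : ∀ σ, Continuous fun y => h (permMap σ y) := fun σ => hh.comp (continuous_permMap σ)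
  have c2 : ∀ σ i, Continuous fun y => h (permMap σ (signMap i y)) :=
    fun σ i => (c1 σ).comp (continuous_signMap i)
  have i1 := fun σ => hτ.integrable _ (c1 σ)
  have i2 := fun σ i => hτ.integrable _ (c2 σ i)
  have e2 : ∀ σ i, ∫ y, h (permMap σ (signMap i y)) ∂τ = ∫ y, h y ∂τ := fun σ i =>
    (hτ.sign i _ (c1 σ)).trans (hτ.perm σ _ hh)
  simp only [tetraAvg]
  have i3 : ∀ σ, Integrable (fun y => h (permMap σ y) + ∑ i, h (permMap σ (signMap i y))) τ :=
    fun σ => (i1 σ).add (integrable_finsetSum _ fun i _ => i2 σ i)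
  rw [integral_div, integral_finsetSum _ fun σ _ => i3 σ]
  have : ∀ σ : Equiv.Perm (Fin 3), ∫ y, (h (permMap σ y) + ∑ i, h (permMap σ (signMap i y))) ∂τ =
      4 * ∫ y, h y ∂τ := by
    intro σ
    rw [integral_add (i1 σ) (integrable_finsetSum _ fun i _ => i2 σ i), hτ.perm σ _ hh,
      integral_finsetSum _ fun i _ => i2 σ i]
    simp only [e2, Fin.sum_univ_three]
    ring
  simp only [this, sum_perm_fin_three]
  ring

lemma IsTetrahedral.moment_eq_zero (hτ : IsTetrahedral τ) (α : Fin 3 → ℕ) {i j : Fin 3}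
    (hij : ¬ (Even (α i) ↔ Even (α j))) : ∫ y : E3, ∏ i, y i ^ α i ∂τ = 0 := by
  obtain ⟨k, hk⟩ : ∃ k : Fin 3, ∀ y : E3, ∏ i, signMap k y i ^ α i = -∏ i, y i ^ α i := by
    have aux : ∀ k : Fin 3, ¬ Even (∑ j, if j = k then 0 else α j) →
        ∀ y : E3, ∏ i, signMap k y i ^ α i = -∏ i, y i ^ α i := by
      intro k hk y
      have h : ∀ j, signMap k y j ^ α j = (-1) ^ (if j = k then 0 else α j) * y j ^ α j := by
        intro j
        by_cases h : j = k
        · simp [h]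
        · simp only [signMap_apply, h, if_false]
          rw [neg_pow]
      simp only [h, Finset.prod_mul_distrib, Finset.prod_pow_eq_pow_sum]
      rw [(Nat.not_even_iff_odd.mp hk).neg_one_pow]
      ring
    by_contra! hcon
    have hev : ∀ k : Fin 3, Even (∑ j, if j = k then 0 else α j) := by
      intro k
      by_contra h
      obtain ⟨y, hy⟩ := hcon k
      exact hy (aux k h y)
    have h0 := hev 0
    have h1 := hev 1
    have h2 := hev 2
    simp [Fin.sum_univ_three, Nat.even_add] at h0 h1 h2
    fin_cases i <;> fin_cases j <;> simp at hij <;> tauto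
  have h := hτ.sign k (fun y => ∏ i, y i ^ α i) (by fun_prop)
  simp only [hk, integral_neg] at h
  linarith

lemma moment_neg_eq_zero (hneg : ∀ h : E3 → ℝ, Continuous h → ∫ y, h (-y) ∂τ = ∫ y, h y ∂τ)
    (α : Fin 3 → ℕ) (hα : ∀ i, Odd (α i)) : ∫ y : E3, ∏ i, y i ^ α i ∂τ = 0 := by
  have h := hneg (fun y => ∏ i, y i ^ α i) (by fun_prop)
  simp only [PiLp.neg_apply, (hα _).neg_pow, Fin.prod_univ_three, mul_neg, neg_mul, neg_neg,
    integral_neg] at h ⊢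
  linarith

lemma IsTetrahedral.moment_comp (hτ : IsTetrahedral τ) (σ : Equiv.Perm (Fin 3)) (α : Fin 3 → ℕ) :
    ∫ y : E3, ∏ i, y i ^ α (σ i) ∂τ = ∫ y : E3, ∏ i, y i ^ α i ∂τ := by
  rw [← hτ.perm σ (fun y => ∏ i, y i ^ α (σ i)) (by fun_prop)]
  refine integral_congr_ae (.of_forall fun y => ?_)
  exact Equiv.prod_comp σ (fun i => y i ^ α i)

variable {I : Ideal (MvPolynomial (Fin 3) ℝ)} {l : MvPolynomial (Fin 3) ℝ →ₗ[ℝ] ℝ}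

theorem IsTetrahedral.integral_linForm_pow_eq_zero (hτ : IsTetrahedral τ)
    (hl : ∀ φ ∈ I, l φ = 0) (h2 : e2 ∈ I) (h4 : e4 ∈ I) (h6 : e6 ∈ I)
    (hodd : e3 ∈ I ∨ ∀ h : E3 → ℝ, Continuous h → ∫ y, h (-y) ∂τ = ∫ y, h y ∂τ)
    {k : ℕ} (hk : k ≠ 0) : ∫ y, l (linForm y ^ k) ∂τ = 0 := by
  set w : (Fin 3 → ℕ) → ℝ := fun α =>
    (Nat.multinomial Finset.univ α : ℝ) * ∫ y : E3, ∏ i, y i ^ α i ∂τ with hw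
  have hexp : ∫ y, l (linForm y ^ k) ∂τ =
      ∑ α ∈ Finset.univ.piAntidiag k, w α * l (∏ i, X i ^ α i) := by
    simp only [linForm_pow]
    rw [integral_finsetSum]
    · refine Finset.sum_congr rfl fun α _ => ?_
      rw [integral_mul_const, integral_const_mul]
    · intro α _
      exact hτ.integrable _ (by fun_prop)
  have hwσ : ∀ (σ : Equiv.Perm (Fin 3)) α, w (α ∘ σ) = w α := by
    intro σ α
    simp only [hw, Function.comp_apply, hτ.moment_comp σ α]
    congr 2
    simp only [Nat.multinomial, Function.comp_apply]
    rw [Equiv.sum_comp σ α, Equiv.prod_comp σ (fun i => (α i).factorial)]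
  have hsym : ∀ σ : Equiv.Perm (Fin 3),
      ∑ α ∈ Finset.univ.piAntidiag k, w α * l (∏ i, X i ^ α i) =
      ∑ α ∈ Finset.univ.piAntidiag k, w α * l (∏ i, X i ^ α (σ i)) := by
    intro σ
    refine (Finset.sum_equiv (Equiv.arrowCongr σ.symm (Equiv.refl ℕ)) ?_ ?_).symm
    · intro α
      simp only [Finset.mem_piAntidiag, Equiv.arrowCongr_apply, Equiv.symm_symm, Equiv.coe_refl,
        Finset.mem_univ, implies_true, and_true]
      rw [show Finset.univ.sum (Equiv.arrowCongr σ.symm (Equiv.refl ℕ) α) = ∑ i, α (σ i) from rfl,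
        Equiv.sum_comp σ α]
    · intro α _
      have : Equiv.arrowCongr σ.symm (Equiv.refl ℕ) α = α ∘ σ := by ext; simp
      rw [this, hwσ]
      rfl
  have hterm : ∀ α ∈ Finset.univ.piAntidiag k,
      ∑ σ : Equiv.Perm (Fin 3), w α * l (∏ i, X i ^ α (σ i)) = 0 := by
    intro α hα
    have hα0 : α ≠ 0 := by
      rintro rfl
      simp [Finset.mem_piAntidiag] at hα
      exact hk hα.symm
    by_cases hpar : ∀ i j, Even (α i) ↔ Even (α j)
    · by_cases hev : Even (α 0)
      · rw [← Finset.mul_sum, ← map_sum,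
          hl _ (even_symmetric_sum_mem h2 h4 h6 α (fun i => (hpar 0 i).mp hev) hα0), mul_zero]
      · have ho : ∀ i, Odd (α i) := fun i => Nat.not_even_iff_odd.mp fun h => hev ((hpar 0 i).mpr h)
        rcases hodd with h3 | hneg
        · exact Finset.sum_eq_zero fun σ _ => by
            rw [hl (∏ i, X i ^ α (σ i)) (odd_monomial_mem h3 (α ∘ σ) fun i => ho _), mul_zero]
        · exact Finset.sum_eq_zero fun σ _ => by
            rw [hw]; simp only [moment_neg_eq_zero hneg α ho, mul_zero, zero_mul]
    · push Not at hpar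
      obtain ⟨i, j, hij⟩ := hpar
      refine Finset.sum_eq_zero fun σ _ => ?_
      rw [hw]
      simp only [hτ.moment_eq_zero α (i := i) (j := j) (by tauto), mul_zero, zero_mul]
  have h6' : (Fintype.card (Equiv.Perm (Fin 3)) : ℝ) * ∫ y, l (linForm y ^ k) ∂τ = 0 := by
    rw [hexp]
    calc _ = ∑ σ : Equiv.Perm (Fin 3), ∑ α ∈ Finset.univ.piAntidiag k,
          w α * l (∏ i, X i ^ α (σ i)) := by
          rw [← Finset.sum_congr rfl fun σ _ => hsym σ]; simp
      _ = 0 := by rw [Finset.sum_comm]; exact Finset.sum_eq_zero hterm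
  exact (mul_eq_zero.mp h6').resolve_left (by simp [Fintype.card_ne_zero])

lemma IsTetrahedral.integral_linForm_pow (hτ : IsTetrahedral τ) (k : ℕ) :
    ∫ y, l (linForm y ^ k) ∂τ = ∫ y, l (C (1 / 24) *
      ∑ σ, (linForm (permMap σ y) ^ k + ∑ i, linForm (permMap σ (signMap i y)) ^ k)) ∂τ := by
  rw [← hτ.integral_tetraAvg (continuous_linForm_pow l k)]
  refine integral_congr_ae (.of_forall fun y => ?_)
  simp only [tetraAvg]
  rw [← smul_eq_C_mul, map_smul]
  simp only [map_sum, map_add, smul_eq_mul]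
  ring

/-- The sum of `(± y₀ Xₐ ± y₁ X_b ± y₂ X_c) ^ k` over even sign changes. -/
noncomputable def signedPowSum (k : ℕ) (y : E3) (a b c : Fin 3) : MvPolynomial (Fin 3) ℝ :=
  (C (y 0) * X a + C (y 1) * X b + C (y 2) * X c) ^ k +
    (C (y 0) * X a - C (y 1) * X b - C (y 2) * X c) ^ k +
    (C (y 1) * X b - C (y 0) * X a - C (y 2) * X c) ^ k +
    (C (y 2) * X c - C (y 0) * X a - C (y 1) * X b) ^ k

lemma tetra_sum_linForm_pow (k : ℕ) (y : E3) :
    ∑ σ, (linForm (permMap σ y) ^ k + ∑ i, linForm (permMap σ (signMap i y)) ^ k) =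
      signedPowSum k y 0 1 2 + signedPowSum k y 1 0 2 + signedPowSum k y 2 1 0 +
        signedPowSum k y 0 2 1 + signedPowSum k y 1 2 0 + signedPowSum k y 2 0 1 := by
  have h : ∀ (σ : Equiv.Perm (Fin 3)) (z : E3),
      linForm (permMap σ⁻¹ z) = ∑ i, C (z i) * X (σ i) := by
    intro σ z
    rw [linForm, ← Equiv.sum_comp σ]
    simp
  have h' : ∀ σ : Equiv.Perm (Fin 3), linForm (permMap σ⁻¹ y) ^ k +
      ∑ i, linForm (permMap σ⁻¹ (signMap i y)) ^ k = signedPowSum k y (σ 0) (σ 1) (σ 2) := by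
    intro σ
    simp only [h, Fin.sum_univ_three, signMap_apply, signedPowSum]
    simp
    ring_nf
  rw [← Equiv.sum_comp (Equiv.inv _)]
  simp only [Equiv.inv_apply, h']
  rw [sum_perm_fin_three]
  rfl

lemma IsTetrahedral.integral_linForm_sq (hτ : IsTetrahedral τ) :
    ∫ y, l (linForm y ^ 2) ∂τ =
      (∫ y : E3, (y 0 ^ 2 + y 1 ^ 2 + y 2 ^ 2) ∂τ) * (l e2 / 3) := by
  rw [hτ.integral_linForm_pow, ← integral_mul_const]
  refine integral_congr_ae (.of_forall fun y => ?_)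
  have h : ∑ σ, (linForm (permMap σ y) ^ 2 + ∑ i, linForm (permMap σ (signMap i y)) ^ 2) =
      C (8 * (y 0 ^ 2 + y 1 ^ 2 + y 2 ^ 2)) * e2 := by
    rw [tetra_sum_linForm_pow]
    simp [map_ofNat, signedPowSum, e2]
    ring
  simp only [h, ← smul_eq_C_mul, map_smul, smul_eq_mul]
  ring

lemma IsTetrahedral.integral_linForm_cube (hτ : IsTetrahedral τ) :
    ∫ y, l (linForm y ^ 3) ∂τ = (∫ y : E3, (y 0 * y 1 * y 2) ∂τ) * (6 * l e3) := by
  rw [hτ.integral_linForm_pow, ← integral_mul_const]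
  refine integral_congr_ae (.of_forall fun y => ?_)
  have h : ∑ σ, (linForm (permMap σ y) ^ 3 + ∑ i, linForm (permMap σ (signMap i y)) ^ 3) =
      C (144 * (y 0 * y 1 * y 2)) * e3 := by
    rw [tetra_sum_linForm_pow]
    simp [map_ofNat, signedPowSum, e3]
    ring
  simp only [h, ← smul_eq_C_mul, map_smul, smul_eq_mul]
  ring

lemma IsTetrahedral.integral_linForm_pow_four (hτ : IsTetrahedral τ) (hl : l (e2 * e2) = 0) :
    ∫ y, l (linForm y ^ 4) ∂τ =
      (∫ y : E3, (y 0 ^ 4 + y 1 ^ 4 + y 2 ^ 4 -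
        3 * (y 0 ^ 2 * y 1 ^ 2 + y 1 ^ 2 * y 2 ^ 2 + y 2 ^ 2 * y 0 ^ 2)) ∂τ) *
        (-(2 / 3) * l e4) := by
  rw [hτ.integral_linForm_pow, ← integral_mul_const]
  refine integral_congr_ae (.of_forall fun y => ?_)
  have h : ∑ σ, (linForm (permMap σ y) ^ 4 + ∑ i, linForm (permMap σ (signMap i y)) ^ 4) =
      C (8 * (y 0 ^ 4 + y 1 ^ 4 + y 2 ^ 4)) * (e2 * e2) +
      C (-16 * (y 0 ^ 4 + y 1 ^ 4 + y 2 ^ 4 -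
        3 * (y 0 ^ 2 * y 1 ^ 2 + y 1 ^ 2 * y 2 ^ 2 + y 2 ^ 2 * y 0 ^ 2))) * e4 := by
    rw [tetra_sum_linForm_pow]
    simp [map_ofNat, signedPowSum, e2, e4]
    ring
  simp only [h, ← smul_eq_C_mul, map_smul, map_add, smul_eq_mul, hl]
  ring

lemma IsTetrahedral.integral_linForm_pow_six (hτ : IsTetrahedral τ)
    (hl : l (e2 * (e2 * e2)) = 0) (hl' : l (e2 * e4) = 0) :
    ∫ y, l (linForm y ^ 6) ∂τ =
      (∫ y : E3, (2 * (y 0 ^ 6 + y 1 ^ 6 + y 2 ^ 6) -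
        15 * (y 0 ^ 4 * y 1 ^ 2 + y 1 ^ 4 * y 0 ^ 2 + y 1 ^ 4 * y 2 ^ 2 + y 2 ^ 4 * y 1 ^ 2 +
          y 2 ^ 4 * y 0 ^ 2 + y 0 ^ 4 * y 2 ^ 2) +
        180 * (y 0 ^ 2 * y 1 ^ 2 * y 2 ^ 2)) ∂τ) * (l e6 / 2) := by
  rw [hτ.integral_linForm_pow, ← integral_mul_const]
  refine integral_congr_ae (.of_forall fun y => ?_)
  have h : ∑ σ, (linForm (permMap σ y) ^ 6 + ∑ i, linForm (permMap σ (signMap i y)) ^ 6) =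
      C (8 * (y 0 ^ 6 + y 1 ^ 6 + y 2 ^ 6)) * (e2 * (e2 * e2)) +
      C (60 * (y 0 ^ 4 * y 1 ^ 2 + y 1 ^ 4 * y 0 ^ 2 + y 1 ^ 4 * y 2 ^ 2 + y 2 ^ 4 * y 1 ^ 2 +
          y 2 ^ 4 * y 0 ^ 2 + y 0 ^ 4 * y 2 ^ 2) - 24 * (y 0 ^ 6 + y 1 ^ 6 + y 2 ^ 6)) *
        (e2 * e4) +
      C (12 * (2 * (y 0 ^ 6 + y 1 ^ 6 + y 2 ^ 6) -
        15 * (y 0 ^ 4 * y 1 ^ 2 + y 1 ^ 4 * y 0 ^ 2 + y 1 ^ 4 * y 2 ^ 2 + y 2 ^ 4 * y 1 ^ 2 +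
          y 2 ^ 4 * y 0 ^ 2 + y 0 ^ 4 * y 2 ^ 2) +
        180 * (y 0 ^ 2 * y 1 ^ 2 * y 2 ^ 2))) * e6 := by
    rw [tetra_sum_linForm_pow]
    simp [map_ofNat, signedPowSum, e2, e4, e6]
    ring
  simp only [h, ← smul_eq_C_mul, map_smul, map_add, smul_eq_mul, hl, hl']
  ring

end TetrahedralMeasure

section SmoothFunctions

open scoped ContDiff

/-- The space of smooth real functions on `E3`. -/
def Smooth : Submodule ℝ (E3 → ℝ) where
  carrier := {g | ContDiff ℝ ∞ g}
  add_mem' {a _} ha hb := ContDiff.add (show ContDiff ℝ ∞ a from ha) hb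
  zero_mem' := show ContDiff ℝ ∞ fun _ : E3 => (0 : ℝ) from contDiff_const
  smul_mem' c a h := (show ContDiff ℝ ∞ a from h).const_smul c

instance : CoeFun Smooth fun _ => E3 → ℝ := ⟨Subtype.val⟩

lemma smooth_contDiff (g : Smooth) : ContDiff ℝ ∞ g := g.2

lemma smooth_continuous (g : Smooth) : Continuous g := (smooth_contDiff g).continuous

lemma smooth_differentiable (g : Smooth) : Differentiable ℝ g :=
  (smooth_contDiff g).differentiable (by simp)

lemma contDiff_fderiv_apply (g : Smooth) (v : E3) : ContDiff ℝ ∞ fun x => fderiv ℝ g x v :=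
  ((smooth_contDiff g).fderiv_right (m := ∞) (by simp)).clm_apply contDiff_const

/-- The partial derivative in the `i`-th coordinate on smooth functions. -/
noncomputable def smoothD (i : Fin 3) : Module.End ℝ Smooth where
  toFun g := ⟨fun x => fderiv ℝ g x (EuclideanSpace.single i 1), contDiff_fderiv_apply g _⟩
  map_add' g h := by
    ext x
    change fderiv ℝ ((g : E3 → ℝ) + (h : E3 → ℝ)) x _ = _
    rw [fderiv_add (smooth_differentiable g x) (smooth_differentiable h x)]
    rfl
  map_smul' c g := by
    ext x
    change fderiv ℝ (c • (g : E3 → ℝ)) x _ = _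
    rw [fderiv_const_smul (smooth_differentiable g x)]
    rfl

lemma smoothD_apply (i : Fin 3) (g : Smooth) (x : E3) :
    smoothD i g x = fderiv ℝ g x (EuclideanSpace.single i 1) := rfl

lemma smoothD_commute (i j : Fin 3) : Commute (smoothD i) (smoothD j) := by
  refine LinearMap.ext fun g => Subtype.ext (funext fun x => ?_)
  have hd : DifferentiableAt ℝ (fderiv ℝ g) x :=
    ((smooth_contDiff g).fderiv_right (m := ∞) (by simp)).differentiable (by simp) x
  have key : ∀ i j, smoothD i (smoothD j g) x =
      fderiv ℝ (fderiv ℝ g) x (EuclideanSpace.single i 1) (EuclideanSpace.single j 1) := by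
    intro i j
    rw [smoothD_apply]
    change fderiv ℝ (fun z => fderiv ℝ g z (EuclideanSpace.single j 1)) x _ = _
    rw [fderiv_clm_apply hd (differentiableAt_const _)]
    simp
  have hs : IsSymmSndFDerivAt ℝ g x :=
    (smooth_contDiff g).contDiffAt.isSymmSndFDerivAt
      (by
      rw [minSmoothness_of_isRCLikeNormedField]
      exact WithTop.coe_le_coe.2 (le_top (a := (2 : ℕ∞))))
  change smoothD i (smoothD j g) x = smoothD j (smoothD i g) x
  rw [key, key, hs]

/-- The action of polynomials on smooth functions as constant-coefficient operators. -/
noncomputable def smoothOp : MvPolynomial (Fin 3) ℝ →ₐ[ℝ] Module.End ℝ Smooth :=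
  opHom smoothD smoothD_commute

/-- The linear functional `φ ↦ (φ(∂) g)(x)`. -/
noncomputable def smoothOpAt (g : Smooth) (x : E3) : MvPolynomial (Fin 3) ℝ →ₗ[ℝ] ℝ where
  toFun φ := smoothOp φ g x
  map_add' := by simp
  map_smul' := by simp

lemma smoothOpAt_apply (g : Smooth) (x : E3) (φ : MvPolynomial (Fin 3) ℝ) :
    smoothOpAt g x φ = smoothOp φ g x := rfl

lemma sum_coord_single (y : E3) : ∑ i, y i • EuclideanSpace.single i (1 : ℝ) = y := by
  ext j
  simp [Fin.sum_univ_three]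
  fin_cases j <;> simp

lemma smoothOp_linForm_apply (g : Smooth) (x y : E3) :
    smoothOp (linForm y) g x = fderiv ℝ g x y := by
  conv_rhs => rw [← sum_coord_single y]
  simp only [map_sum, map_smul, linForm, ← smul_eq_C_mul]
  simp only [smoothOp, opHom_X, LinearMap.sum_apply, LinearMap.smul_apply]
  simp [smoothD_apply, Fin.sum_univ_three]

lemma hasDerivAt_smooth_line (g : Smooth) (x y : E3) (s : ℝ) :
    HasDerivAt (fun s : ℝ => g (x + s • y)) (smoothOp (linForm y) g (x + s • y)) s := by
  rw [smoothOp_linForm_apply]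
  have h1 : HasDerivAt (fun s : ℝ => x + s • y) y s := by
    simpa using ((hasDerivAt_id s).smul_const y).const_add x
  exact ((smooth_differentiable g _).hasFDerivAt).comp_hasDerivAt s h1

lemma hasDerivAt_smooth_linForm_pow (g : Smooth) (x y : E3) (k : ℕ) (s : ℝ) :
    HasDerivAt (fun s : ℝ => smoothOp (linForm y ^ k) g (x + s • y))
      (smoothOp (linForm y ^ (k + 1)) g (x + s • y)) s := by
  have h := hasDerivAt_smooth_line (smoothOp (linForm y ^ k) g) x y s
  rwa [← Module.End.mul_apply, ← map_mul, ← pow_succ'] at h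

lemma continuous_smoothOp_linForm_pow (g : Smooth) (k : ℕ) :
    Continuous fun p : E3 × E3 => smoothOp (linForm p.1 ^ k) g p.2 := by
  simp only [← smoothOpAt_apply, linForm_pow]
  refine continuous_finsetSum _ fun α _ => ?_
  refine Continuous.mul (by fun_prop) ?_
  exact (smooth_continuous (smoothOp (∏ i, X i ^ α i) g)).comp continuous_snd

variable {τ : Measure E3} [IsFiniteMeasure τ] {K : Set E3}

lemma hasDerivAt_integral_smoothOp (hK : IsCompact K) (hτK : ∀ᵐ y ∂τ, y ∈ K) (g : Smooth)
    (x : E3) (k : ℕ) (s : ℝ) :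
    HasDerivAt (fun s : ℝ => ∫ y, smoothOp (linForm y ^ k) g (x + s • y) ∂τ)
      (∫ y, smoothOp (linForm y ^ (k + 1)) g (x + s • y) ∂τ) s := by
  have hc : ∀ k, Continuous fun p : ℝ × E3 => smoothOp (linForm p.2 ^ k) g (x + p.1 • p.2) :=
    fun k => (continuous_smoothOp_linForm_pow g k).comp
      (f := fun p : ℝ × E3 => (p.2, x + p.1 • p.2)) (by fun_prop)
  have hb : ∀ k, ∃ M : ℝ, ∀ t ∈ Set.Icc (s - 1) (s + 1), ∀ y ∈ K,
      ‖smoothOp (linForm y ^ k) g (x + t • y)‖ ≤ M := by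
    intro k
    obtain ⟨M, hM⟩ :=
      ((isCompact_Icc (a := s - 1) (b := s + 1)).prod hK).exists_bound_of_continuousOn
      (hc k).continuousOn
    exact ⟨M, fun t ht y hy => hM (t, y) ⟨ht, hy⟩⟩
  have hm : ∀ k t, AEStronglyMeasurable (fun y => smoothOp (linForm y ^ k) g (x + t • y)) τ :=
    fun k t => ((hc k).comp (Continuous.prodMk_right t)).aestronglyMeasurable
  obtain ⟨M, hM⟩ := hb k
  obtain ⟨M', hM'⟩ := hb (k + 1)
  refine (hasDerivAt_integral_of_dominated_loc_of_deriv_le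
    (F := fun t y => smoothOp (linForm y ^ k) g (x + t • y))
    (F' := fun t y => smoothOp (linForm y ^ (k + 1)) g (x + t • y)) (bound := fun _ => M')
    (Icc_mem_nhds (sub_one_lt s) (lt_add_one s)) (.of_forall (hm k)) ?_ (hm (k + 1) s) ?_
    (integrable_const _) ?_).2
  · exact Integrable.of_bound (hm k s) M
      (hτK.mono fun y hy => hM s ⟨by linarith, by linarith⟩ y hy)
  · exact hτK.mono fun y hy t ht => hM' t ht y hy
  · exact .of_forall fun y t _ => hasDerivAt_smooth_linForm_pow g x y k t

theorem integral_linForm_pow_eq_zero_of_mean_value (hK : IsCompact K) (hτK : ∀ᵐ y ∂τ, y ∈ K)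
    (g : Smooth) (c : ℝ) (hg : ∀ x, ∀ s : ℝ, 0 < s → ∫ y, g (x + s • y) ∂τ = c * g x) (x : E3)
    {k : ℕ} (hk : k ≠ 0) : ∫ y, smoothOp (linForm y ^ k) g x ∂τ = 0 := by
  have hd := hasDerivAt_integral_smoothOp hK hτK g x
  have hpos : ∀ k : ℕ, ∀ s : ℝ, 0 < s →
      ∫ y, smoothOp (linForm y ^ (k + 1)) g (x + s • y) ∂τ = 0 := by
    intro k
    induction k with
    | zero =>
      intro s hs
      refine (hd 0 s).unique ((hasDerivAt_const s (c * g x)).congr_of_eventuallyEq ?_)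
      filter_upwards [lt_mem_nhds hs] with t ht
      simpa using hg x t ht
    | succ k ih =>
      intro s hs
      refine (hd (k + 1) s).unique ((hasDerivAt_const s 0).congr_of_eventuallyEq ?_)
      filter_upwards [lt_mem_nhds hs] with t ht
      exact ih t ht
  obtain ⟨k, rfl⟩ := Nat.exists_eq_succ_of_ne_zero hk
  have hcont := (hd (k + 1) 0).continuousAt
  have h1 : Filter.Tendsto (fun s : ℝ => ∫ y, smoothOp (linForm y ^ (k + 1)) g (x + s • y) ∂τ)
      (nhdsWithin 0 (Set.Ioi 0)) (nhds 0) :=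
    tendsto_const_nhds.congr' (by
      filter_upwards [self_mem_nhdsWithin] with s hs using (hpos k s hs).symm)
  have h2 := tendsto_nhds_unique (hcont.tendsto.mono_left nhdsWithin_le_nhds) h1
  simpa using h2

theorem mean_value_of_integral_linForm_pow_eq_zero (hK : IsCompact K) (hτK : ∀ᵐ y ∂τ, y ∈ K)
    (g : Smooth) {N : ℕ} (hN : ∀ y, smoothOp (linForm y ^ N) g = 0) (x : E3)
    (h0 : ∀ k : ℕ, k ≠ 0 → ∫ y, smoothOp (linForm y ^ k) g x ∂τ = 0) (s : ℝ) :
    ∫ y, g (x + s • y) ∂τ = τ.real Set.univ * g x := by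
  have hd := hasDerivAt_integral_smoothOp hK hτK g x
  have hconst : ∀ k, (∀ s : ℝ, ∫ y, smoothOp (linForm y ^ (k + 1)) g (x + s • y) ∂τ = 0) →
      ∀ s : ℝ, ∫ y, smoothOp (linForm y ^ k) g (x + s • y) ∂τ =
        ∫ y, smoothOp (linForm y ^ k) g x ∂τ := by
    intro k hk s
    have := is_const_of_deriv_eq_zero (fun s => (hd k s).differentiableAt)
      (fun s => (hd k s).deriv.trans (hk s)) s 0
    simpa using this
  have hall : ∀ j k, k + j = N + 1 → k ≠ 0 →
      ∀ s : ℝ, ∫ y, smoothOp (linForm y ^ k) g (x + s • y) ∂τ = 0 := by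
    intro j
    induction j with
    | zero =>
      intro k hk _ s
      have : ∀ y, smoothOp (linForm y ^ k) g = 0 := fun y => by
        rw [show k = 1 + N by omega, pow_add, map_mul, Module.End.mul_apply, hN, map_zero]
      exact integral_eq_zero_of_ae (.of_forall fun y => by simp only [this]; rfl)
    | succ j ih =>
      intro k hk hk0 s
      rw [hconst k (ih (k + 1) (by omega) (by omega)), h0 k hk0]
  have := hconst 0 (hall N 1 (by omega) one_ne_zero) s
  simpa [Measure.real] using this

end SmoothFunctions

section PolynomialFunctions

open scoped ContDiff

lemma hasFDerivAt_eval_toFn (p : MvPolynomial (Fin 3) ℝ) (x : E3) :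
    HasFDerivAt (fun x : E3 => eval (toFn x) p)
      (∑ i, eval (toFn x) (pderiv i p) • EuclideanSpace.proj (𝕜 := ℝ) i) x := by
  induction p using MvPolynomial.induction_on with
  | C a => simpa using hasFDerivAt_const a x
  | add p q hp hq =>
    simp only [map_add, add_smul, Finset.sum_add_distrib]
    exact hp.fun_add hq
  | mul_X p j hp =>
    have hX : HasFDerivAt (fun x : E3 => x j) (EuclideanSpace.proj (𝕜 := ℝ) j) x :=
      (EuclideanSpace.proj (𝕜 := ℝ) j).hasFDerivAt
    simp only [map_mul, eval_X]
    refine (hp.fun_mul hX).congr_fderiv (ContinuousLinearMap.ext fun v => ?_)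
    fin_cases j <;>
      simp [Fin.sum_univ_three, pderiv_X, Pi.single_apply, toFn] <;> ring

lemma contDiff_eval_toFn (p : MvPolynomial (Fin 3) ℝ) :
    ContDiff ℝ ∞ fun x : E3 => eval (toFn x) p := by
  induction p using MvPolynomial.induction_on with
  | C a => simpa using contDiff_const
  | add p q hp hq => simpa using hp.add hq
  | mul_X p j hp =>
    simp only [map_mul, eval_X]
    exact hp.mul (EuclideanSpace.proj (𝕜 := ℝ) j).contDiff

/-- A polynomial as a smooth function on `E3`. -/
noncomputable def evalSmooth : MvPolynomial (Fin 3) ℝ →ₗ[ℝ] Smooth where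
  toFun p := ⟨fun x => eval (toFn x) p, contDiff_eval_toFn p⟩
  map_add' _ _ := Subtype.ext (funext fun x => by simp)
  map_smul' _ _ := Subtype.ext (funext fun x => by simp)

lemma evalSmooth_apply (p : MvPolynomial (Fin 3) ℝ) (x : E3) :
    evalSmooth p x = eval (toFn x) p := rfl

lemma evalSmooth_injective : Function.Injective evalSmooth := fun _ _ h =>
  MvPolynomial.funext fun x => congrFun (congrArg Subtype.val h) (pt x)

lemma smoothOp_evalSmooth (φ p : MvPolynomial (Fin 3) ℝ) :
    smoothOp φ (evalSmooth p) = evalSmooth (dop φ p) := by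
  rw [dop_eq_opHom]
  refine (opHom_intertwine evalSmooth (fun i p => Subtype.ext (funext fun x => ?_)) φ p).symm
  change _ = fderiv ℝ (fun x => eval (toFn x) p) x _
  rw [(hasFDerivAt_eval_toFn p x).fderiv]
  fin_cases i <;> simp [evalSmooth_apply, Fin.sum_univ_three]

lemma smoothOp_evalSmooth_eq_zero_iff {φ p : MvPolynomial (Fin 3) ℝ} :
    smoothOp φ (evalSmooth p) = 0 ↔ dop φ p = 0 := by
  rw [smoothOp_evalSmooth, map_eq_zero_iff _ evalSmooth_injective]

end PolynomialFunctions

section Interpolation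

lemma eq_sum_pow_of_hasDerivAt_chain (n : ℕ) (H : ℕ → ℝ → ℝ)
    (hH : ∀ k t, HasDerivAt (H k) (H (k + 1) t) t) (hn : ∀ t, H n t = 0) :
    ∃ c : ℕ → ℝ, ∀ t, H 0 t = ∑ k ∈ Finset.range n, c k * t ^ k := by
  induction n generalizing H with
  | zero => exact ⟨0, by simpa using hn⟩
  | succ n ih =>
    obtain ⟨c, hc⟩ := ih (fun k => H (k + 1)) (fun k t => hH (k + 1) t) hn
    refine ⟨fun k => k.casesOn (H 0 0) fun k => c k / (k + 1), fun t => ?_⟩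
    have hd : ∀ t, HasDerivAt
        (fun t => H 0 t - ∑ k ∈ Finset.range n, c k / (k + 1) * t ^ (k + 1)) 0 t := by
      intro t
      have h1 := HasDerivAt.fun_sum (u := Finset.range n) fun k _ =>
        ((hasDerivAt_pow (k + 1) t).const_mul (c k / ((k : ℝ) + 1)))
      refine ((hH 0 t).sub h1).congr_deriv ?_
      rw [hc, ← Finset.sum_sub_distrib]
      refine Finset.sum_eq_zero fun k _ => ?_
      have : (k : ℝ) + 1 ≠ 0 := by positivity
      push_cast
      field_simp
      simp
    have h0 := is_const_of_deriv_eq_zero (fun s => (hd s).differentiableAt)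
      (fun s => (hd s).deriv) t 0
    rw [Finset.sum_range_succ']
    simp at h0
    simp
    linarith

/-- The Lagrange basis polynomials for the nodes `0, …, 5`. -/
noncomputable def lagrangeSix (m : ℕ) : Polynomial ℝ :=
  Lagrange.basis (Finset.range 6) (fun i : ℕ => (i : ℝ)) m

lemma eq_sum_lagrangeSix (H : ℕ → ℝ → ℝ) (hH : ∀ k t, HasDerivAt (H k) (H (k + 1) t) t)
    (h6 : ∀ t, H 6 t = 0) (t : ℝ) :
    H 0 t = ∑ m ∈ Finset.range 6, H 0 m * (lagrangeSix m).eval t := by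
  obtain ⟨c, hc⟩ := eq_sum_pow_of_hasDerivAt_chain 6 H hH h6
  set P : Polynomial ℝ := ∑ k ∈ Finset.range 6, Polynomial.C (c k) * Polynomial.X ^ k with hP
  have hPe : ∀ t, H 0 t = P.eval t := fun t => by simp [hc, hP, Polynomial.eval_finsetSum]
  have hdeg : P.degree < (Finset.range 6).card := by
    rw [Finset.card_range]
    exact Polynomial.degree_sum_fin_lt (fun k : Fin 6 => c k) |>.trans_eq' (by
      rw [hP, Finset.sum_range])
  have h := Lagrange.eq_interpolate (v := fun i : ℕ => (i : ℝ))
    (fun i _ j _ h => Nat.cast_injective h) hdeg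
  rw [hPe, h, Lagrange.interpolate_apply]
  simp only [Polynomial.eval_finsetSum, Polynomial.eval_mul, Polynomial.eval_C, hPe]
  rfl

lemma linForm_single (i : Fin 3) : linForm (EuclideanSpace.single i 1) = X i := by
  fin_cases i <;> simp [linForm]

lemma smooth_line_eq_sum_lagrangeSix {g : Smooth} {i : Fin 3} (hg : smoothOp (X i ^ 6) g = 0)
    (x : E3) (t : ℝ) :
    g (x + t • EuclideanSpace.single i 1) =
      ∑ m ∈ Finset.range 6, g (x + (m : ℝ) • EuclideanSpace.single i 1) *
        (lagrangeSix m).eval t := by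
  have h := eq_sum_lagrangeSix
    (fun k t => smoothOp (linForm (EuclideanSpace.single i 1) ^ k) g
      (x + t • EuclideanSpace.single i 1))
    (fun k t => hasDerivAt_smooth_linForm_pow g x _ k t)
    (fun t => by simp only [linForm_single, hg]; rfl) t
  simpa using h

lemma smooth_eq_sum_lagrangeSix {g : Smooth} (hg : ∀ i, smoothOp (X i ^ 6) g = 0) (a b c : ℝ) :
    g (pt ![a, b, c]) = ∑ i ∈ Finset.range 6, ∑ j ∈ Finset.range 6, ∑ k ∈ Finset.range 6,
      g (pt ![(i : ℝ), j, k]) *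
        ((lagrangeSix i).eval a * (lagrangeSix j).eval b * (lagrangeSix k).eval c) := by
  have h0 : ∀ a b c : ℝ, pt ![a, b, c] = pt ![0, b, c] + a • EuclideanSpace.single 0 1 := by
    intro a b c; ext j; fin_cases j <;> simp
  have h1 : ∀ a b c : ℝ, pt ![a, b, c] = pt ![a, 0, c] + b • EuclideanSpace.single 1 1 := by
    intro a b c; ext j; fin_cases j <;> simp
  have h2 : ∀ a b c : ℝ, pt ![a, b, c] = pt ![a, b, 0] + c • EuclideanSpace.single 2 1 := by
    intro a b c; ext j; fin_cases j <;> simp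
  have k0 : ∀ a b c : ℝ, g (pt ![a, b, c]) =
      ∑ m ∈ Finset.range 6, g (pt ![(m : ℝ), b, c]) * (lagrangeSix m).eval a := by
    intro a b c
    rw [h0, smooth_line_eq_sum_lagrangeSix (hg 0)]
    simp only [← h0]
  have k1 : ∀ a b c : ℝ, g (pt ![a, b, c]) =
      ∑ m ∈ Finset.range 6, g (pt ![a, (m : ℝ), c]) * (lagrangeSix m).eval b := by
    intro a b c
    rw [h1, smooth_line_eq_sum_lagrangeSix (hg 1)]
    simp only [← h1]
  have k2 : ∀ a b c : ℝ, g (pt ![a, b, c]) =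
      ∑ m ∈ Finset.range 6, g (pt ![a, b, (m : ℝ)]) * (lagrangeSix m).eval c := by
    intro a b c
    rw [h2, smooth_line_eq_sum_lagrangeSix (hg 2)]
    simp only [← h2]
  rw [k0]
  refine Finset.sum_congr rfl fun i _ => ?_
  rw [k1, Finset.sum_mul]
  refine Finset.sum_congr rfl fun j _ => ?_
  rw [k2, Finset.sum_mul, Finset.sum_mul]
  exact Finset.sum_congr rfl fun k _ => by ring

theorem exists_polynomial_of_tendsto {f : E3 → ℝ} {g : ℕ → Smooth}
    (hg : ∀ n i, smoothOp (X i ^ 6) (g n) = 0)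
    (hf : ∀ x, Filter.Tendsto (fun n => g n x) Filter.atTop (nhds (f x))) :
    ∃ p : MvPolynomial (Fin 3) ℝ, ∀ x, f x = eval (toFn x) p := by
  refine ⟨∑ i ∈ Finset.range 6, ∑ j ∈ Finset.range 6, ∑ k ∈ Finset.range 6,
    C (f (pt ![(i : ℝ), j, k])) * (Polynomial.aeval (X 0) (lagrangeSix i) *
      Polynomial.aeval (X 1) (lagrangeSix j) * Polynomial.aeval (X 2) (lagrangeSix k)),
    fun x => ?_⟩
  have hx : x = pt ![x 0, x 1, x 2] := by ext j; fin_cases j <;> rfl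
  have hev : ∀ (i : Fin 3) (P : Polynomial ℝ),
      eval (toFn x) (Polynomial.aeval (X i) P) = P.eval (x i) := by
    intro i P
    rw [← coe_aeval_eq_eval, RingHom.coe_coe, ← Polynomial.aeval_algHom_apply, aeval_X]
    exact Polynomial.coe_aeval_eq_eval (x i) ▸ rfl
  simp only [map_sum, map_mul, eval_C, hev]
  refine tendsto_nhds_unique (hf x) ?_
  conv => enter [1, n]; rw [hx, smooth_eq_sum_lagrangeSix (hg n)]
  exact tendsto_finsetSum _ fun i _ => tendsto_finsetSum _ fun j _ =>
    tendsto_finsetSum _ fun k _ => (hf _).mul_const _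

end Interpolation

section Mollification

open scoped ContDiff Convolution

variable {τ : Measure E3} [IsFiniteMeasure τ] {K : Set E3}

lemma integral_convolution_eq (hK : IsCompact K) (hτK : ∀ᵐ y ∂τ, y ∈ K) {f φ : E3 → ℝ}
    (hf : Continuous f) (hφ : Continuous φ) (hφc : HasCompactSupport φ) {c : ℝ}
    (hmean : ∀ x, ∀ s : ℝ, 0 < s → ∫ y, f (x + s • y) ∂τ = c * f x) (x : E3) {s : ℝ}
    (hs : 0 < s) :
    ∫ y, (φ ⋆[ContinuousLinearMap.lsmul ℝ ℝ, volume] f) (x + s • y) ∂τ =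
      c * (φ ⋆[ContinuousLinearMap.lsmul ℝ ℝ, volume] f) x := by
  have hF : Continuous fun p : E3 × E3 => f (x + s • p.1 - p.2) :=
    hf.comp (by fun_prop)
  obtain ⟨M, hM⟩ := (hK.prod hφc).exists_bound_of_continuousOn hF.continuousOn
  have hint : Integrable (fun p : E3 × E3 => φ p.2 * f (x + s • p.1 - p.2))
      (τ.prod volume) := by
    refine Integrable.mono' (((hφ.integrable_of_hasCompactSupport hφc).norm.const_mul M).comp_snd τ)
      ((hφ.comp continuous_snd).mul hF).aestronglyMeasurable ?_
    filter_upwards [Measure.quasiMeasurePreserving_fst.ae hτK] with p hp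
    rw [norm_mul, mul_comm]
    by_cases h : p.2 ∈ tsupport φ
    · exact mul_le_mul_of_nonneg_right (hM p ⟨hp, h⟩) (norm_nonneg _)
    · simp [image_eq_zero_of_notMem_tsupport h]
  simp only [convolution_def, ContinuousLinearMap.lsmul_apply, smul_eq_mul]
  rw [integral_integral_swap hint, ← integral_const_mul]
  refine integral_congr_ae (.of_forall fun t => ?_)
  have h := hmean (x - t) s hs
  simp only [integral_const_mul, add_sub_right_comm x]
  rw [h]
  ring

theorem exists_smooth_approximation (hK : IsCompact K) (hτK : ∀ᵐ y ∂τ, y ∈ K) {f : E3 → ℝ}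
    (hf : Continuous f) {c : ℝ}
    (hmean : ∀ x, ∀ s : ℝ, 0 < s → ∫ y, f (x + s • y) ∂τ = c * f x) :
    ∃ g : ℕ → Smooth,
      (∀ x, Filter.Tendsto (fun n => g n x) Filter.atTop (nhds (f x))) ∧
      ∀ n x, ∀ s : ℝ, 0 < s → ∫ y, g n (x + s • y) ∂τ = c * g n x := by
  let φ : ℕ → ContDiffBump (0 : E3) := fun n =>
    ⟨1 / ((n : ℝ) + 1), 2 * (1 / ((n : ℝ) + 1)), by positivity, by
      have : 0 < 1 / ((n : ℝ) + 1) := by positivity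
      linarith⟩
  refine ⟨fun n => ⟨(φ n).normed volume ⋆[ContinuousLinearMap.lsmul ℝ ℝ, volume] f,
    (φ n).hasCompactSupport_normed.contDiff_convolution_left _ (φ n).contDiff_normed
      hf.locallyIntegrable⟩, fun x => ?_, fun n x s hs => ?_⟩
  · refine ContDiffBump.convolution_tendsto_right_of_continuous ?_ hf x
    simpa [φ] using (tendsto_one_div_add_atTop_nhds_zero_nat (𝕜 := ℝ)).const_mul 2
  · exact integral_convolution_eq hK hτK hf (φ n).continuous_normed
      (φ n).hasCompactSupport_normed hmean x hs

end Mollification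

section MeanValue

variable {τ : Measure E3} {g : Smooth}

lemma IsTetrahedral.smoothOp_e2 (hτ : IsTetrahedral τ)
    (hg : ∀ x, ∀ k : ℕ, k ≠ 0 → ∫ y, smoothOp (linForm y ^ k) g x ∂τ = 0)
    (hm : ∫ y, (y 0 ^ 2 + y 1 ^ 2 + y 2 ^ 2) ∂τ ≠ 0) : smoothOp e2 g = 0 := by
  refine Subtype.ext (funext fun x => ?_)
  have h := (hτ.integral_linForm_sq (l := smoothOpAt g x)).symm.trans (hg x 2 two_ne_zero)
  simpa [hm, smoothOpAt_apply] using h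

lemma IsTetrahedral.smoothOp_e3 (hτ : IsTetrahedral τ)
    (hg : ∀ x, ∀ k : ℕ, k ≠ 0 → ∫ y, smoothOp (linForm y ^ k) g x ∂τ = 0)
    (hm : ∫ y, y 0 * y 1 * y 2 ∂τ ≠ 0) : smoothOp e3 g = 0 := by
  refine Subtype.ext (funext fun x => ?_)
  have h := (hτ.integral_linForm_cube (l := smoothOpAt g x)).symm.trans (hg x 3 three_ne_zero)
  simpa [hm, smoothOpAt_apply] using h

lemma smoothOpAt_mul_eq_zero {φ : MvPolynomial (Fin 3) ℝ} (h : smoothOp φ g = 0)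
    (ψ : MvPolynomial (Fin 3) ℝ) (x : E3) : smoothOpAt g x (φ * ψ) = 0 := by
  rw [smoothOpAt_apply, mul_comm, map_mul, Module.End.mul_apply, h, map_zero]
  rfl

lemma IsTetrahedral.smoothOp_e4 (hτ : IsTetrahedral τ)
    (hg : ∀ x, ∀ k : ℕ, k ≠ 0 → ∫ y, smoothOp (linForm y ^ k) g x ∂τ = 0)
    (h2 : smoothOp e2 g = 0)
    (hm : ∫ y, (y 0 ^ 4 + y 1 ^ 4 + y 2 ^ 4 -
      3 * (y 0 ^ 2 * y 1 ^ 2 + y 1 ^ 2 * y 2 ^ 2 + y 2 ^ 2 * y 0 ^ 2)) ∂τ ≠ 0) :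
    smoothOp e4 g = 0 := by
  refine Subtype.ext (funext fun x => ?_)
  have h := (hτ.integral_linForm_pow_four (smoothOpAt_mul_eq_zero h2 e2 x)).symm.trans
    (hg x 4 four_ne_zero)
  simpa [hm, smoothOpAt_apply] using h

lemma IsTetrahedral.smoothOp_e6 (hτ : IsTetrahedral τ)
    (hg : ∀ x, ∀ k : ℕ, k ≠ 0 → ∫ y, smoothOp (linForm y ^ k) g x ∂τ = 0)
    (h2 : smoothOp e2 g = 0)
    (hm : ∫ y, (2 * (y 0 ^ 6 + y 1 ^ 6 + y 2 ^ 6) -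
      15 * (y 0 ^ 4 * y 1 ^ 2 + y 1 ^ 4 * y 0 ^ 2 + y 1 ^ 4 * y 2 ^ 2 + y 2 ^ 4 * y 1 ^ 2 +
        y 2 ^ 4 * y 0 ^ 2 + y 0 ^ 4 * y 2 ^ 2) +
      180 * (y 0 ^ 2 * y 1 ^ 2 * y 2 ^ 2)) ∂τ ≠ 0) :
    smoothOp e6 g = 0 := by
  refine Subtype.ext (funext fun x => ?_)
  have h := (hτ.integral_linForm_pow_six (smoothOpAt_mul_eq_zero h2 (e2 * e2) x)
    (smoothOpAt_mul_eq_zero h2 e4 x)).symm.trans (hg x 6 (by norm_num))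
  simpa [hm, smoothOpAt_apply] using h

variable [IsFiniteMeasure τ] {K : Set E3}

theorem IsTetrahedral.mean_value_iff_exists_polynomial (hτ : IsTetrahedral τ) (hK : IsCompact K)
    (hτK : ∀ᵐ y ∂τ, y ∈ K) {φ₁ φ₂ φ₃ : MvPolynomial (Fin 3) ℝ}
    (hann : ∀ g : Smooth,
      (∀ x, ∀ k : ℕ, k ≠ 0 → ∫ y, smoothOp (linForm y ^ k) g x ∂τ = 0) →
        smoothOp φ₁ g = 0 ∧ smoothOp φ₂ g = 0 ∧ smoothOp φ₃ g = 0)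
    (hmem : ∀ I : Ideal (MvPolynomial (Fin 3) ℝ), φ₁ ∈ I → φ₂ ∈ I → φ₃ ∈ I →
      e2 ∈ I ∧ e4 ∈ I ∧ e6 ∈ I)
    (hodd : φ₂ = e3 ∨ ∀ h : E3 → ℝ, Continuous h → ∫ y, h (-y) ∂τ = ∫ y, h y ∂τ)
    {f : E3 → ℝ} (hf : Continuous f) :
    (∀ x, ∀ s : ℝ, 0 < s → ∫ y, f (x + s • y) ∂τ = τ.real Set.univ * f x) ↔
      ∃ p : MvPolynomial (Fin 3) ℝ,
        dop φ₁ p = 0 ∧ dop φ₂ p = 0 ∧ dop φ₃ p = 0 ∧ ∀ x, f x = eval (toFn x) p := by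
  constructor
  · intro hmean
    have hsmooth : ∀ g : Smooth,
        (∀ x, ∀ s : ℝ, 0 < s → ∫ y, g (x + s • y) ∂τ = τ.real Set.univ * g x) →
          smoothOp φ₁ g = 0 ∧ smoothOp φ₂ g = 0 ∧ smoothOp φ₃ g = 0 := fun g hg =>
      hann g fun x k hk => integral_linForm_pow_eq_zero_of_mean_value hK hτK g _ hg x hk
    obtain ⟨g, hgf, hg⟩ := exists_smooth_approximation hK hτK hf hmean
    obtain ⟨p, hp⟩ := exists_polynomial_of_tendsto (fun n i => by
      obtain ⟨h1, h2, h3⟩ := hsmooth (g n) (hg n)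
      obtain ⟨h2, h4, h6⟩ := hmem (opAnnihilator smoothD smoothD_commute (g n)) h1 h2 h3
      exact X_pow_six_mem h2 h4 h6 i) hgf
    obtain rfl : f = evalSmooth p := funext hp
    obtain ⟨h1, h2, h3⟩ := hsmooth (evalSmooth p) hmean
    exact ⟨p, smoothOp_evalSmooth_eq_zero_iff.1 h1, smoothOp_evalSmooth_eq_zero_iff.1 h2,
      smoothOp_evalSmooth_eq_zero_iff.1 h3, hp⟩
  · rintro ⟨p, h1, h2, h3, hp⟩
    obtain rfl : f = evalSmooth p := funext hp
    set I := opAnnihilator smoothD smoothD_commute (evalSmooth p)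
    have hI2 : φ₂ ∈ I := smoothOp_evalSmooth_eq_zero_iff.2 h2
    obtain ⟨h2, h4, h6⟩ := hmem I (smoothOp_evalSmooth_eq_zero_iff.2 h1) hI2
      (smoothOp_evalSmooth_eq_zero_iff.2 h3)
    obtain ⟨N, hN⟩ := exists_linForm_pow_mem h2 h4 h6
    intro x s _
    refine mean_value_of_integral_linForm_pow_eq_zero hK hτK _ hN x (fun k hk => ?_) s
    refine hτ.integral_linForm_pow_eq_zero (I := I) (l := smoothOpAt (evalSmooth p) x)
      (fun φ hφ => ?_) h2 h4 h6 (hodd.imp_left fun h => by rwa [← h]) hk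
    rw [smoothOpAt_apply, show smoothOp φ (evalSmooth p) = 0 from hφ]
    rfl

end MeanValue

section Symmetry

/-- The sign patterns of the vertices of the regular tetrahedron. -/
def vertexSign : Fin 4 → Fin 3 → ℤ :=
  ![![1, -1, -1], ![-1, 1, -1], ![-1, -1, 1], ![1, 1, 1]]

/-- The vertices of the regular tetrahedron, as an indexed family. -/
noncomputable def vertex (i : Fin 4) : E3 := pt fun j => (vertexSign i j : ℝ)

@[simp] lemma vertex_apply (i : Fin 4) (j : Fin 3) : vertex i j = vertexSign i j := rfl

/-- The face with base edge `{vertex k | k ≠ i, j}` and apex opposite to `vertex i`. -/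
noncomputable def face (r : ℝ) (i j : Fin 4) : Set E3 :=
  convexHull ℝ (insert (-(r / 3) • vertex i) (vertex '' {k | k ≠ i ∧ k ≠ j}))

lemma face_eq_of_perm (r : ℝ) {i j k l : Fin 4} (h : ∀ m, (m ≠ i ∧ m ≠ j) ↔ (m = k ∨ m = l)) :
    face r i j = convexHull ℝ {vertex k, vertex l, -(r / 3) • vertex i} := by
  have : {m | m ≠ i ∧ m ≠ j} = {k, l} := Set.ext h
  rw [face, this, Set.image_pair, Set.insert_comm, Set.pair_comm (vertex l)]

lemma faceSet_eq_iUnion (r : ℝ) :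
    faceSet r = ⋃ p : {p : Fin 4 × Fin 4 // p.1 ≠ p.2}, face r p.1.1 p.1.2 := by
  have hA : vA = vertex 0 := by ext j; fin_cases j <;> simp [vA, vertexSign]
  have hB : vB = vertex 1 := by ext j; fin_cases j <;> simp [vB, vertexSign]
  have hC : vC = vertex 2 := by ext j; fin_cases j <;> simp [vC, vertexSign]
  have hD : vD = vertex 3 := by ext j; fin_cases j <;> simp [vD, vertexSign]
  have ha : va r = -(r / 3) • vertex 0 := by ext j; fin_cases j <;> simp [va, vertexSign]
  have hb : vb r = -(r / 3) • vertex 1 := by ext j; fin_cases j <;> simp [vb, vertexSign]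
  have hc : vc r = -(r / 3) • vertex 2 := by ext j; fin_cases j <;> simp [vc, vertexSign]
  have hd : vd r = -(r / 3) • vertex 3 := by ext j; fin_cases j <;> simp [vd, vertexSign]
  have hu : (⋃ p : {p : Fin 4 × Fin 4 // p.1 ≠ p.2}, face r p.1.1 p.1.2) =
      ⋃ i, ⋃ j, ⋃ _ : i ≠ j, face r i j := by
    ext x; simp
  rw [hu, faceSet, hA, hB, hC, hD, ha, hb, hc, hd,
    ← face_eq_of_perm r (i := 2) (j := 3) (by decide),
    ← face_eq_of_perm r (i := 3) (j := 2) (by decide),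
    ← face_eq_of_perm r (i := 1) (j := 3) (by decide),
    ← face_eq_of_perm r (i := 3) (j := 1) (by decide),
    ← face_eq_of_perm r (i := 1) (j := 2) (by decide),
    ← face_eq_of_perm r (i := 2) (j := 1) (by decide),
    ← face_eq_of_perm r (i := 0) (j := 3) (by decide),
    ← face_eq_of_perm r (i := 3) (j := 0) (by decide),
    ← face_eq_of_perm r (i := 0) (j := 2) (by decide),
    ← face_eq_of_perm r (i := 2) (j := 0) (by decide),
    ← face_eq_of_perm r (i := 0) (j := 1) (by decide),
    ← face_eq_of_perm r (i := 1) (j := 0) (by decide)]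
  ext x
  simp only [Set.mem_union, Set.mem_iUnion, Fin.exists_fin_succ, Fin.exists_fin_zero]
  simp
  tauto

/-- The coordinate permutation `permMap σ` as a linear isometry. -/
noncomputable def permIso (σ : Equiv.Perm (Fin 3)) : E3 ≃ₗᵢ[ℝ] E3 :=
  LinearIsometryEquiv.piLpCongrLeft 2 ℝ ℝ σ.symm

lemma permIso_apply (σ : Equiv.Perm (Fin 3)) (y : E3) : permIso σ y = permMap σ y := rfl

/-- The sign change `signMap i` as a linear isometry. -/
noncomputable def signIso (i : Fin 3) : E3 ≃ₗᵢ[ℝ] E3 :=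
  LinearIsometryEquiv.piLpCongrRight 2 fun j =>
    if j = i then LinearIsometryEquiv.refl ℝ ℝ else LinearIsometryEquiv.neg ℝ

lemma signIso_apply (i : Fin 3) (y : E3) : signIso i y = signMap i y := by
  ext j
  by_cases h : j = i <;> simp [signIso, h]

/-- `L` permutes the vertices of the tetrahedron according to `π`. -/
def PermutesVertices (L : E3 ≃ₗᵢ[ℝ] E3) (π : Equiv.Perm (Fin 4)) : Prop :=
  ∀ i, L (vertex i) = vertex (π i)

lemma PermutesVertices.trans {L L' : E3 ≃ₗᵢ[ℝ] E3} {π π' : Equiv.Perm (Fin 4)}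
    (h : PermutesVertices L π) (h' : PermutesVertices L' π') :
    PermutesVertices (L.trans L') (π.trans π') := fun i => by
  simp [h i, h' (π i)]

lemma permutesVertices_permIso {σ : Equiv.Perm (Fin 3)} {π : Equiv.Perm (Fin 4)}
    (h : ∀ i j, vertexSign i (σ j) = vertexSign (π i) j) : PermutesVertices (permIso σ) π :=
  fun i => by ext j; simp [permIso_apply, h]

lemma permutesVertices_signIso {l : Fin 3} {π : Equiv.Perm (Fin 4)}
    (h : ∀ i j, (if j = l then vertexSign i j else -vertexSign i j) = vertexSign (π i) j) :
    PermutesVertices (signIso l) π :=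
  fun i => by ext j; simp [signIso_apply, ← h]

lemma exists_permutesVertices_permIso (σ : Equiv.Perm (Fin 3)) :
    ∃ π, PermutesVertices (permIso σ) π := by
  have : ∀ σ : Equiv.Perm (Fin 3), ∃ π : Equiv.Perm (Fin 4),
      ∀ i j, vertexSign i (σ j) = vertexSign (π i) j := by decide
  exact (this σ).imp fun π h => permutesVertices_permIso h

lemma exists_permutesVertices_signIso (l : Fin 3) :
    ∃ π, PermutesVertices (signIso l) π := by
  have : ∀ l : Fin 3, ∃ π : Equiv.Perm (Fin 4),
      ∀ i j, (if j = l then vertexSign i j else -vertexSign i j) = vertexSign (π i) j := by decide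
  exact (this l).imp fun π h => permutesVertices_signIso h

/-- Invariance of a function under the rotation and reflection group of the tetrahedron. -/
structure IsTetraInvariant (h : E3 → ℝ) : Prop where
  perm : ∀ σ y, h (permMap σ y) = h y
  sign : ∀ i y, h (signMap i y) = h y

lemma exists_symmetry {i j : Fin 4} (hij : i ≠ j) :
    ∃ (L : E3 ≃ₗᵢ[ℝ] E3) (π : Equiv.Perm (Fin 4)), PermutesVertices L π ∧ π 2 = i ∧ π 3 = j ∧
      ∀ h : E3 → ℝ, IsTetraInvariant h → ∀ y, h (L y) = h y := by
  have key : ∀ i j : Fin 4, i ≠ j → ∃ (σ : Equiv.Perm (Fin 3)) (π : Equiv.Perm (Fin 4)),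
      (∀ i j, vertexSign i (σ j) = vertexSign (π i) j) ∧
      ((π 2 = i ∧ π 3 = j) ∨ ∃ (l : Fin 3) (π' : Equiv.Perm (Fin 4)),
      (∀ i j, (if j = l then vertexSign i j else -vertexSign i j) = vertexSign (π' i) j) ∧
      π' (π 2) = i ∧ π' (π 3) = j) := by decide
  obtain ⟨σ, π, hσ, ⟨h2, h3⟩ | ⟨l, π', hl, h2, h3⟩⟩ := key i j hij
  · exact ⟨permIso σ, π, permutesVertices_permIso hσ, h2, h3, fun h hh y => hh.perm σ y⟩
  · refine ⟨(permIso σ).trans (signIso l), π.trans π',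
      (permutesVertices_permIso hσ).trans (permutesVertices_signIso hl), h2, h3, fun h hh y => ?_⟩
    rw [LinearIsometryEquiv.trans_apply, signIso_apply, hh.sign, permIso_apply, hh.perm]

lemma PermutesVertices.image_face {L : E3 ≃ₗᵢ[ℝ] E3} {π : Equiv.Perm (Fin 4)}
    (h : PermutesVertices L π) (r : ℝ) (i j : Fin 4) :
    L '' face r i j = face r (π i) (π j) := by
  have himg := LinearMap.image_convexHull (L.toLinearEquiv : E3 →ₗ[ℝ] E3)
    (insert (-(r / 3) • vertex i) (vertex '' {k | k ≠ i ∧ k ≠ j}))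
  refine himg.trans ?_
  rw [face, Set.image_insert_eq, Set.image_image]
  congr 2
  · simp [h i]
  · ext x
    constructor
    · rintro ⟨k, ⟨h1, h2⟩, rfl⟩
      exact ⟨π k, ⟨by simpa using h1, by simpa using h2⟩, (h k).symm⟩
    · rintro ⟨k, ⟨h1, h2⟩, rfl⟩
      refine ⟨π.symm k, ⟨?_, ?_⟩, ?_⟩
      · rintro rfl; simp at h1
      · rintro rfl; simp at h2
      · exact (h _).trans (by simp)

lemma PermutesVertices.preimage_faceSet {L : E3 ≃ₗᵢ[ℝ] E3} {π : Equiv.Perm (Fin 4)}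
    (h : PermutesVertices L π) (r : ℝ) : L ⁻¹' faceSet r = faceSet r := by
  rw [← Set.image_eq_image L.injective, Set.image_preimage_eq _ L.surjective, faceSet_eq_iUnion,
    Set.image_iUnion]
  simp only [h.image_face]
  ext x
  simp only [Set.mem_iUnion, Subtype.exists, Prod.exists, exists_prop]
  constructor
  · rintro ⟨i, j, hij, hx⟩
    exact ⟨π.symm i, π.symm j, by simpa using hij, by simpa using hx⟩
  · rintro ⟨i, j, hij, hx⟩
    exact ⟨π i, π j, by simpa using hij, hx⟩

end Symmetry

section SurfaceMeasure

open scoped NNReal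

variable {L : ℝ × ℝ →ₗ[ℝ] E3}

lemma isClosedEmbedding_affine (hL : Function.Injective L) (p : E3) :
    Topology.IsClosedEmbedding fun z => p + L z :=
  (Homeomorph.addLeft p).isClosedEmbedding.comp
    (LinearMap.isClosedEmbedding_of_injective (LinearMap.ker_eq_bot.2 hL))

lemma exists_map_affine_eq_smul_hausdorffMeasure (hL : Function.Injective L) (p : E3) :
    ∃ κ : ℝ≥0, κ ≠ 0 ∧ Measure.map (fun z => p + L z) volume =
      κ • (μH[2] : Measure E3).restrict (Set.range fun z => p + L z) := by
  let e : (ℝ × ℝ) ≃L[ℝ] L.range := (LinearEquiv.ofInjective L hL).toContinuousLinearEquiv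
  let ι : L.range → E3 := fun w => p + w
  have hι : Isometry ι := (isometry_add_left p).comp isometry_subtype_coe
  have hfin : Module.finrank ℝ L.range = 2 := by
    rw [LinearMap.finrank_range_of_inj hL]; simp
  have hH : (μH[2] : Measure L.range).IsAddHaarMeasure := by
    have := isAddHaarMeasure_hausdorffMeasure (E := L.range)
    rwa [hfin] at this
  refine ⟨Measure.addHaarScalarFactor (Measure.map e volume) μH[2],
    (Measure.addHaarScalarFactor_pos_of_isAddHaarMeasure _ _).ne', ?_⟩
  have hcomp : (fun z => p + L z) = ι ∘ e := rfl
  have hrange : Set.range (fun z => p + L z) = Set.range ι := by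
    rw [hcomp, e.surjective.range_comp]
  rw [hrange, ← hι.map_hausdorffMeasure (Or.inl zero_le_two), hcomp,
    ← Measure.map_map hι.continuous.measurable e.continuous.measurable, ← Measure.map_smul,
    ← Measure.isAddLeftInvariant_eq_smul]

lemma exists_hausdorffMeasure_affine_image (hL : Function.Injective L) (p : E3) :
    ∃ κ : ℝ, 0 < κ ∧ (∀ S : Set (ℝ × ℝ), volume S = 0 → μH[2] ((fun z => p + L z) '' S) = 0) ∧
      (∀ S : Set (ℝ × ℝ), volume S ≠ ⊤ → μH[2] ((fun z => p + L z) '' S) ≠ ⊤) ∧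
      ∀ (S : Set (ℝ × ℝ)) (h : E3 → ℝ),
        ∫ y in (fun z => p + L z) '' S, h y ∂μH[2] = κ * ∫ z in S, h (p + L z) := by
  obtain ⟨κ, hκ, hmap⟩ := exists_map_affine_eq_smul_hausdorffMeasure hL p
  set Q : ℝ × ℝ → E3 := fun z => p + L z with hQ
  have hemb : MeasurableEmbedding Q := (isClosedEmbedding_affine hL p).measurableEmbedding
  have hvol : ∀ S, volume S = κ * μH[2] (Q '' S) := by
    intro S
    have h := congrArg (fun m => m (Q '' S)) hmap
    simp only [hemb.map_apply, Set.preimage_image_eq _ hemb.injective] at h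
    rw [h, Measure.smul_apply, Measure.restrict_eq_self _ (Set.image_subset_range Q S)]
    rfl
  refine ⟨(κ : ℝ)⁻¹, by positivity, fun S hS => ?_, fun S hS => ?_, fun S h => ?_⟩
  · rw [hvol] at hS
    exact (mul_eq_zero.1 hS).resolve_left (by simpa using hκ)
  · rw [hvol] at hS
    intro htop
    rw [htop, ENNReal.mul_top (by simpa using hκ)] at hS
    exact hS rfl
  · have h1 := hemb.setIntegral_map (μ := volume) h (Q '' S)
    rw [Set.preimage_image_eq _ hemb.injective, hmap, Measure.restrict_smul,
      Measure.restrict_restrict_of_subset (Set.image_subset_range Q S),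
      integral_smul_nnreal_measure] at h1
    rw [← h1, NNReal.smul_def, smul_eq_mul, inv_mul_cancel_left₀ (by simpa using hκ)]

end SurfaceMeasure

section FaceParametrization

/-- The parameter domain of a face. -/
def baseTriangle : Set (ℝ × ℝ) := {z | 0 ≤ z.1 ∧ z.2 ≤ 1 - z.1 ∧ -z.2 ≤ 1 - z.1}

/-- The union of the three lines bounding `baseTriangle`. -/
def baseEdges : Set (ℝ × ℝ) := {z | z.1 = 0 ∨ z.2 = 1 - z.1 ∨ -z.2 = 1 - z.1}

lemma isCompact_baseTriangle : IsCompact baseTriangle := by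
  refine (isCompact_Icc (a := ((0 : ℝ), (-1 : ℝ))) (b := (1, 1))).of_isClosed_subset ?_ ?_
  · exact (isClosed_le continuous_const continuous_fst).inter
      ((isClosed_le continuous_snd (by fun_prop)).inter (isClosed_le (f := fun z : ℝ × ℝ => -z.2)
        (by fun_prop) (by fun_prop)))
  · rintro ⟨v, w⟩ ⟨h1, h2, h3⟩
    simp only at h1 h2 h3
    exact ⟨⟨h1, by simp; linarith⟩, ⟨by simp; linarith, by simp; linarith⟩⟩

lemma convex_baseTriangle : Convex ℝ baseTriangle := by
  rintro ⟨v, w⟩ ⟨h1, h2, h3⟩ ⟨v', w'⟩ ⟨h1', h2', h3'⟩ a b ha hb hab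
  simp only at h1 h2 h3 h1' h2' h3'
  refine ⟨?_, ?_, ?_⟩ <;> simp <;> nlinarith

lemma volume_baseEdges : volume baseEdges = 0 := by
  have hm : MeasurableSet baseEdges := by
    refine IsClosed.measurableSet ?_
    exact (isClosed_eq continuous_fst continuous_const).union
      ((isClosed_eq continuous_snd (by fun_prop)).union (isClosed_eq (by fun_prop) (by fun_prop)))
  rw [Measure.volume_eq_prod, Measure.measure_prod_null hm]
  filter_upwards [(measure_eq_zero_iff_ae_notMem.1 (measure_singleton (0 : ℝ)))] with v hv
  refine Set.Finite.measure_zero (Set.Finite.subset (Set.toFinite {1 - v, -(1 - v)}) ?_) _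
  rintro w (h | h | h)
  · exact absurd h hv
  · exact Or.inl h
  · exact Or.inr (by simp only at h; simp; linarith)

/-- The linear part of the parametrization of the face `face r 2 3`. -/
noncomputable def faceLin (r : ℝ) : ℝ × ℝ →ₗ[ℝ] E3 where
  toFun z := pt ![z.2 + r / 3 * z.1, -z.2 + r / 3 * z.1, (1 - r / 3) * z.1]
  map_add' z z' := by ext j; fin_cases j <;> simp <;> ring
  map_smul' c z := by ext j; fin_cases j <;> simp <;> ring

/-- The parametrization of the face `face r 2 3`. -/
noncomputable def faceMap (r : ℝ) (z : ℝ × ℝ) : E3 := pt ![0, 0, -1] + faceLin r z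

lemma faceMap_eq (r : ℝ) (z : ℝ × ℝ) :
    faceMap r z = pt ![z.2 + r / 3 * z.1, -z.2 + r / 3 * z.1, -1 + (1 - r / 3) * z.1] := by
  ext j; fin_cases j <;> simp [faceMap, faceLin]

lemma continuous_faceMap (r : ℝ) : Continuous (faceMap r) :=
  continuous_const.add (LinearMap.continuous_of_finiteDimensional _)

lemma faceLin_injective {r : ℝ} (hr : 0 < r) : Function.Injective (faceLin r) := by
  rw [← LinearMap.ker_eq_bot, LinearMap.ker_eq_bot']
  rintro ⟨v, w⟩ h
  have h0 := congrArg (fun y : E3 => y 0) h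
  have h1 := congrArg (fun y : E3 => y 1) h
  simp [faceLin] at h0 h1
  have hv : v = 0 := by
    have : r * v = 0 := by linarith
    exact (mul_eq_zero.1 this).resolve_left hr.ne'
  subst hv
  simp_all

lemma combination_mem_convexHull {s : Set E3} {u v w : E3} (hu : u ∈ s) (hv : v ∈ s) (hw : w ∈ s)
    {a b c : ℝ} (ha : 0 ≤ a) (hb : 0 ≤ b) (hc : 0 ≤ c) (habc : a + b + c = 1) :
    a • u + b • v + c • w ∈ convexHull ℝ s := by
  have h := (convex_convexHull ℝ s).sum_mem (t := Finset.univ) (w := ![a, b, c]) (z := ![u, v, w])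
    (by intro i _; fin_cases i <;> simpa) (by simpa [Fin.sum_univ_three] using habc)
    (by intro i _; fin_cases i <;> simp <;> exact subset_convexHull ℝ s ‹_›)
  simpa [Fin.sum_univ_three] using h

lemma fin_four_eq_zero_or_eq_one : ∀ {k : Fin 4}, k ≠ 2 → k ≠ 3 → k = 0 ∨ k = 1 := by
  decide

lemma face_two_three (r : ℝ) : face r 2 3 = faceMap r '' baseTriangle := by
  apply Set.Subset.antisymm
  · refine convexHull_min ?_ ?_
    · rintro y (rfl | ⟨k, ⟨h2, h3⟩, rfl⟩)
      · refine ⟨(1, 0), by simp [baseTriangle], ?_⟩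
        rw [faceMap_eq]
        ext j; fin_cases j <;> simp [vertexSign]; ring
      · obtain rfl | rfl := fin_four_eq_zero_or_eq_one h2 h3
        · refine ⟨(0, 1), by simp [baseTriangle], ?_⟩
          rw [faceMap_eq]
          ext j; fin_cases j <;> simp [vertexSign]
        · refine ⟨(0, -1), by simp [baseTriangle], ?_⟩
          rw [faceMap_eq]
          ext j; fin_cases j <;> simp [vertexSign]
    · have h := (convex_baseTriangle.linear_image (faceLin r)).translate (pt ![0, 0, -1])
      rwa [Set.image_image] at h
  · rintro _ ⟨⟨v, w⟩, ⟨h1, h2, h3⟩, rfl⟩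
    simp only at h1 h2 h3
    have h := combination_mem_convexHull
      (s := insert (-(r / 3) • vertex 2) (vertex '' {k | k ≠ 2 ∧ k ≠ 3}))
      (u := vertex 0) (v := vertex 1) (w := -(r / 3) • vertex 2)
      (Or.inr ⟨0, by decide, rfl⟩) (Or.inr ⟨1, by decide, rfl⟩) (Or.inl rfl)
      (a := (1 - v + w) / 2) (b := (1 - v - w) / 2) (c := v)
      (by linarith) (by linarith) h1 (by ring)
    rw [face]
    convert h using 1
    rw [faceMap_eq]
    ext j; fin_cases j <;> simp [vertexSign] <;> ring

end FaceParametrization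

section SurfaceIntegral

lemma isCompact_face (r : ℝ) (i j : Fin 4) : IsCompact (face r i j) :=
  Set.Finite.isCompact_convexHull (𝕜 := ℝ) ((Set.toFinite _).insert _)

lemma isCompact_faceSet (r : ℝ) : IsCompact (faceSet r) := by
  rw [faceSet_eq_iUnion]
  exact isCompact_iUnion fun p => isCompact_face r _ _

lemma inner_vertex (i k : Fin 4) : inner ℝ (vertex i) (vertex k) = if i = k then 3 else -1 := by
  have h : ∀ i k : Fin 4, ∑ j, vertexSign k j * vertexSign i j = if i = k then 3 else -1 := by
    decide
  have h' := congrArg (Int.cast : ℤ → ℝ) (h i k)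
  simp only [PiLp.inner_apply, vertex_apply]
  push_cast at h'
  simpa using h'

lemma inner_vertex_le_of_mem_face {r : ℝ} (hr : 0 < r) {i j : Fin 4} (hij : i ≠ j) {y : E3}
    (hy : y ∈ face r i j) :
    inner ℝ (vertex i) y ≤ inner ℝ (vertex j) y ∧
      ∀ k, k ≠ i → inner ℝ (vertex j) y ≤ inner ℝ (vertex k) y := by
  have hconv : ∀ k l : Fin 4, Convex ℝ {y : E3 | inner ℝ (vertex k) y ≤ inner ℝ (vertex l) y} := by
    intro k l y hy z hz a b ha hb _
    simp only [Set.mem_ofPred_eq, inner_add_right, inner_smul_right] at *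
    nlinarith
  have hmem : ∀ k l : Fin 4, (k = i ∧ l = j ∨ k = j ∧ l ≠ i) →
      inner ℝ (vertex k) y ≤ inner ℝ (vertex l) y := by
    intro k l hkl
    refine convexHull_min (t := {y : E3 | inner ℝ (vertex k) y ≤ inner ℝ (vertex l) y})
      ?_ (hconv k l) hy
    rintro _ (rfl | ⟨m, ⟨h1, h2⟩, rfl⟩)
    · simp only [Set.mem_ofPred_eq, inner_smul_right, inner_vertex]
      rcases hkl with ⟨rfl, rfl⟩ | ⟨rfl, hl⟩
      · simp [hij.symm]; linarith
      · simp [hij.symm, hl]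
    · simp only [Set.mem_ofPred_eq, inner_vertex]
      rcases hkl with ⟨rfl, rfl⟩ | ⟨rfl, hl⟩
      · simp [h1.symm, h2.symm]
      · simp only [h2.symm, if_false]
        split_ifs <;> norm_num
  exact ⟨hmem i j (Or.inl ⟨rfl, rfl⟩), fun k hk => hmem j k (Or.inr ⟨rfl, hk⟩)⟩

/-- The points at which two of the forms ordering the vertices on `face r i j` agree. -/
def tieSet (i j : Fin 4) : Set E3 :=
  {y | inner ℝ (vertex i) y = inner ℝ (vertex j) y ∨
    ∃ k, k ≠ i ∧ k ≠ j ∧ inner ℝ (vertex j) y = inner ℝ (vertex k) y}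

lemma face_inter_face_subset {r : ℝ} (hr : 0 < r) {i j i' j' : Fin 4} (hij : i ≠ j)
    (hij' : i' ≠ j') (h : i ≠ i' ∨ j ≠ j') : face r i j ∩ face r i' j' ⊆ tieSet i j := by
  rintro y ⟨hy, hy'⟩
  obtain ⟨h1, h2⟩ := inner_vertex_le_of_mem_face hr hij hy
  obtain ⟨h1', h2'⟩ := inner_vertex_le_of_mem_face hr hij' hy'
  by_cases hi : i = i'
  · subst hi
    have hj : j ≠ j' := by simpa using h
    exact Or.inr ⟨j', hij'.symm, hj.symm, le_antisymm (h2 j' hij'.symm) (h2' j hij.symm)⟩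
  · exact Or.inl (le_antisymm h1 (((h2 i' (Ne.symm hi)).trans h1').trans (h2' i hi)))

lemma faceMap_mem_tieSet {r : ℝ} (hr : 0 < r) {z : ℝ × ℝ} (h : faceMap r z ∈ tieSet 2 3) :
    z ∈ baseEdges := by
  obtain ⟨v, w⟩ := z
  rw [faceMap_eq] at h
  simp only [tieSet, Set.mem_ofPred_eq, PiLp.inner_apply, vertex_apply, Fin.sum_univ_three] at h
  rcases h with h | ⟨k, h2, h3, h⟩
  · simp [vertexSign] at h
    have : r * v = 0 := by linarith
    exact Or.inl ((mul_eq_zero.1 this).resolve_left hr.ne')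
  · obtain rfl | rfl := fin_four_eq_zero_or_eq_one h2 h3
    · simp [vertexSign] at h
      exact Or.inr (Or.inr (by simp only; linarith))
    · simp [vertexSign] at h
      exact Or.inr (Or.inl (by simp only; linarith))

lemma PermutesVertices.inner_apply {L : E3 ≃ₗᵢ[ℝ] E3} {π : Equiv.Perm (Fin 4)}
    (h : PermutesVertices L π) (i : Fin 4) (y : E3) :
    inner ℝ (vertex (π i)) (L y) = inner ℝ (vertex i) y := by
  rw [← h i, LinearIsometryEquiv.inner_map_map]

lemma hausdorffMeasure_face_inter_tieSet {r : ℝ} (hr : 0 < r) {i j : Fin 4} (hij : i ≠ j) :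
    μH[2] (face r i j ∩ tieSet i j) = 0 := by
  obtain ⟨L, π, hL, rfl, rfl, -⟩ := exists_symmetry hij
  obtain ⟨κ, -, hnull, -⟩ := exists_hausdorffMeasure_affine_image (faceLin_injective hr)
    (pt ![0, 0, -1])
  have hsub : face r (π 2) (π 3) ∩ tieSet (π 2) (π 3) ⊆ L '' (faceMap r '' baseEdges) := by
    rw [← hL.image_face, face_two_three]
    rintro _ ⟨⟨_, ⟨z, hz, rfl⟩, rfl⟩, ht⟩
    refine ⟨_, ⟨z, faceMap_mem_tieSet hr ?_, rfl⟩, rfl⟩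
    rcases ht with h | ⟨k, h2, h3, h⟩
    · rw [hL.inner_apply, hL.inner_apply] at h
      exact Or.inl h
    · obtain ⟨k, rfl⟩ := π.surjective k
      rw [hL.inner_apply, hL.inner_apply] at h
      exact Or.inr ⟨k, by simpa using h2, by simpa using h3, h⟩
  refine measure_mono_null hsub ?_
  rw [L.isometry.hausdorffMeasure_image (Or.inl zero_le_two)]
  exact hnull _ volume_baseEdges

lemma aedisjoint_face {r : ℝ} (hr : 0 < r) :
    Pairwise (Function.onFun (AEDisjoint (μH[2] : Measure E3))
      fun p : {p : Fin 4 × Fin 4 // p.1 ≠ p.2} => face r p.1.1 p.1.2) := by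
  rintro ⟨⟨i, j⟩, hij⟩ ⟨⟨i', j'⟩, hij'⟩ hne
  refine measure_mono_null (Set.subset_inter Set.inter_subset_left
    (face_inter_face_subset hr hij hij' ?_)) (hausdorffMeasure_face_inter_tieSet hr hij)
  by_contra! h
  exact hne (by simpa using h)

lemma hausdorffMeasure_faceSet_ne_top {r : ℝ} (hr : 0 < r) : μH[2] (faceSet r) ≠ ⊤ := by
  rw [faceSet_eq_iUnion]
  refine ((measure_iUnion_fintype_le _ _).trans_lt (ENNReal.sum_lt_top.2 ?_)).ne
  rintro ⟨⟨i, j⟩, hij⟩ -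
  obtain ⟨L, π, hL, rfl, rfl, -⟩ := exists_symmetry hij
  obtain ⟨κ, -, -, hfin, -⟩ := exists_hausdorffMeasure_affine_image (faceLin_injective hr)
    (pt ![0, 0, -1])
  simp only
  rw [← hL.image_face, L.isometry.hausdorffMeasure_image (Or.inl zero_le_two), face_two_three]
  exact (hfin _ isCompact_baseTriangle.measure_ne_top).lt_top

/-- Hausdorff measure on the union of the faces. -/
noncomputable def faceMeasure (r : ℝ) : Measure E3 := (μH[2] : Measure E3).restrict (faceSet r)

lemma isFiniteMeasure_faceMeasure {r : ℝ} (hr : 0 < r) : IsFiniteMeasure (faceMeasure r) :=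
  ⟨by simpa [faceMeasure] using (hausdorffMeasure_faceSet_ne_top hr).lt_top⟩

lemma ae_faceMeasure_mem (r : ℝ) : ∀ᵐ y ∂faceMeasure r, y ∈ faceSet r :=
  ae_restrict_mem (isCompact_faceSet r).measurableSet

lemma integrable_faceMeasure {r : ℝ} (hr : 0 < r) {h : E3 → ℝ} (hh : Continuous h) :
    Integrable h (faceMeasure r) :=
  hh.continuousOn.integrableOn_of_subset_isCompact (isCompact_faceSet r)
    (isCompact_faceSet r).measurableSet subset_rfl (hausdorffMeasure_faceSet_ne_top hr)

lemma integral_faceMeasure_comp {r : ℝ} {L : E3 ≃ₗᵢ[ℝ] E3} (hL : L ⁻¹' faceSet r = faceSet r)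
    (h : E3 → ℝ) : ∫ y, h (L y) ∂faceMeasure r = ∫ y, h y ∂faceMeasure r := by
  have hp := (L.toIsometryEquiv.measurePreserving_hausdorffMeasure 2).restrict_preimage
    (isCompact_faceSet r).measurableSet
  have hpre : L.toIsometryEquiv ⁻¹' faceSet r = faceSet r := hL
  rw [hpre] at hp
  exact hp.integral_comp L.toHomeomorph.measurableEmbedding h

lemma isTetrahedral_faceMeasure {r : ℝ} (hr : 0 < r) : IsTetrahedral (faceMeasure r) where
  integrable _ hh := integrable_faceMeasure hr hh
  perm σ h _ := by
    obtain ⟨π, hπ⟩ := exists_permutesVertices_permIso σ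
    exact integral_faceMeasure_comp (hπ.preimage_faceSet r) h
  sign i h _ := by
    obtain ⟨π, hπ⟩ := exists_permutesVertices_signIso i
    simpa only [signIso_apply] using integral_faceMeasure_comp (hπ.preimage_faceSet r) h

theorem exists_integral_faceMeasure {r : ℝ} (hr : 0 < r) :
    ∃ κ : ℝ, 0 < κ ∧ ∀ h : E3 → ℝ, Continuous h → IsTetraInvariant h →
      ∫ y, h y ∂faceMeasure r = κ * ∫ z in baseTriangle, h (faceMap r z) := by
  obtain ⟨κ, hκ, -, -, hint⟩ := exists_hausdorffMeasure_affine_image (faceLin_injective hr)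
    (pt ![0, 0, -1])
  refine ⟨Fintype.card {p : Fin 4 × Fin 4 // p.1 ≠ p.2} * κ, ?_, fun h hh hinv => ?_⟩
  · have : 0 < Fintype.card {p : Fin 4 × Fin 4 // p.1 ≠ p.2} := by decide
    positivity
  have hface : ∀ p : {p : Fin 4 × Fin 4 // p.1 ≠ p.2}, ∫ y in face r p.1.1 p.1.2, h y ∂μH[2] =
      κ * ∫ z in baseTriangle, h (faceMap r z) := by
    rintro ⟨⟨i, j⟩, hij⟩
    obtain ⟨L, π, hL, rfl, rfl, hhL⟩ := exists_symmetry hij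
    have hp := (L.toIsometryEquiv.measurePreserving_hausdorffMeasure 2).setIntegral_image_emb
      L.toHomeomorph.measurableEmbedding h (face r 2 3)
    have himg : L.toIsometryEquiv '' face r 2 3 = face r (π 2) (π 3) := hL.image_face r 2 3
    rw [himg] at hp
    refine hp.trans ?_
    rw [face_two_three]
    refine Eq.trans ?_ (hint baseTriangle h)
    exact integral_congr_ae (.of_forall fun y => hhL h hinv y)
  have hI := integrable_faceMeasure hr hh
  rw [faceMeasure, faceSet_eq_iUnion] at hI ⊢
  rw [integral_iUnion_ae (fun p => (isCompact_face r _ _).measurableSet.nullMeasurableSet)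
    (aedisjoint_face hr) hI, tsum_fintype]
  simp only [hface, Finset.sum_const, Finset.card_univ, nsmul_eq_mul, mul_assoc]

end SurfaceIntegral

section Cube

lemma neg_faceMap_three_mem {z : ℝ × ℝ} (hz : z ∈ baseTriangle) :
    -faceMap 3 z ∈ face 3 0 1 ∪ face 3 1 0 := by
  obtain ⟨v, w⟩ := z
  obtain ⟨h1, h2, h3⟩ := hz
  simp only at h1 h2 h3
  have key : ∀ i j : Fin 4, i ≠ j → i ≠ 2 → i ≠ 3 → j ≠ 2 → j ≠ 3 → ∀ a b c : ℝ,
      0 ≤ a → 0 ≤ b → 0 ≤ c → a + b + c = 1 →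
      a • -(3 / 3 : ℝ) • vertex i + b • vertex 2 + c • vertex 3 ∈ face 3 i j :=
    fun i j _ hi2 hi3 hj2 hj3 _ _ _ ha hb hc habc =>
      combination_mem_convexHull (Or.inl rfl) (Or.inr ⟨2, ⟨hi2.symm, hj2.symm⟩, rfl⟩)
        (Or.inr ⟨3, ⟨hi3.symm, hj3.symm⟩, rfl⟩) ha hb hc habc
  rcases le_total 0 w with hw | hw
  · left
    convert key 0 1 (by decide) (by decide) (by decide) (by decide) (by decide)
      w ((1 - w + v) / 2) ((1 - w - v) / 2) hw (by linarith) (by linarith) (by ring) using 1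
    rw [faceMap_eq]
    ext j; fin_cases j <;> simp [vertexSign] <;> ring
  · right
    convert key 1 0 (by decide) (by decide) (by decide) (by decide) (by decide)
      (-w) ((1 + w + v) / 2) ((1 + w - v) / 2) (by linarith) (by linarith) (by linarith)
      (by ring) using 1
    rw [faceMap_eq]
    ext j; fin_cases j <;> simp [vertexSign] <;> ring

lemma neg_mem_faceSet_three {y : E3} (hy : y ∈ faceSet 3) : -y ∈ faceSet 3 := by
  rw [faceSet_eq_iUnion, Set.mem_iUnion] at hy
  obtain ⟨⟨⟨i, j⟩, hij⟩, hy⟩ := hy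
  obtain ⟨L, π, hL, rfl, rfl, -⟩ := exists_symmetry hij
  simp only at hy
  rw [← hL.image_face, face_two_three] at hy
  obtain ⟨_, ⟨z, hz, rfl⟩, rfl⟩ := hy
  rw [← map_neg, ← Set.mem_preimage, hL.preimage_faceSet, faceSet_eq_iUnion, Set.mem_iUnion]
  rcases neg_faceMap_three_mem hz with h | h
  · exact ⟨⟨(0, 1), by decide⟩, h⟩
  · exact ⟨⟨(1, 0), by decide⟩, h⟩

lemma integral_faceMeasure_three_neg (h : E3 → ℝ) :
    ∫ y, h (-y) ∂faceMeasure 3 = ∫ y, h y ∂faceMeasure 3 := by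
  refine integral_faceMeasure_comp (L := LinearIsometryEquiv.neg ℝ) ?_ h
  ext y
  exact ⟨fun hy => by simpa using neg_mem_faceSet_three hy, neg_mem_faceSet_three⟩

end Cube

section Coefficients

lemma integral_baseTriangle {h : ℝ × ℝ → ℝ} (hh : Continuous h) :
    ∫ z in baseTriangle, h z = ∫ v in (0 : ℝ)..1, ∫ w in (-(1 - v))..(1 - v), h (v, w) := by
  have hm : MeasurableSet baseTriangle := isCompact_baseTriangle.measurableSet
  have hi : Integrable (baseTriangle.indicator h) (volume.prod volume) :=
    (hh.continuousOn.integrableOn_compact isCompact_baseTriangle).integrable_indicator hm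
  rw [← integral_indicator hm, Measure.volume_eq_prod, integral_prod _ hi,
    intervalIntegral.integral_of_le zero_le_one, ← integral_Icc_eq_integral_Ioc,
    ← integral_indicator measurableSet_Icc]
  congr 1 with v
  by_cases hv : v ∈ Set.Icc (0 : ℝ) 1
  · rw [Set.indicator_of_mem hv, intervalIntegral.integral_of_le (by linarith [hv.2]),
      ← integral_Icc_eq_integral_Ioc, ← integral_indicator measurableSet_Icc]
    congr 1 with w
    have hiff : (v, w) ∈ baseTriangle ↔ w ∈ Set.Icc (-(1 - v)) (1 - v) :=
      ⟨fun h => ⟨by linarith [h.2.2], h.2.1⟩, fun h => ⟨hv.1, h.2, by linarith [h.1]⟩⟩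
    by_cases hw : w ∈ Set.Icc (-(1 - v)) (1 - v)
    · rw [Set.indicator_of_mem hw, Set.indicator_of_mem (hiff.2 hw)]
    · rw [Set.indicator_of_notMem hw, Set.indicator_of_notMem (mt hiff.1 hw)]
  · rw [Set.indicator_of_notMem hv]
    refine integral_eq_zero_of_ae (.of_forall fun w => Set.indicator_of_notMem ?_ h)
    rintro ⟨h1, h2, h3⟩
    exact hv ⟨h1, by simp only at h2 h3; linarith⟩

lemma integral_polynomial (a b c d e f g h x y : ℝ) :
    ∫ t in x..y, (a + b * t + c * t ^ 2 + d * t ^ 3 + e * t ^ 4 + f * t ^ 5 + g * t ^ 6 +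
      h * t ^ 7) = a * (y - x) + b * (y ^ 2 - x ^ 2) / 2 + c * (y ^ 3 - x ^ 3) / 3 +
        d * (y ^ 4 - x ^ 4) / 4 + e * (y ^ 5 - x ^ 5) / 5 + f * (y ^ 6 - x ^ 6) / 6 +
        g * (y ^ 7 - x ^ 7) / 7 + h * (y ^ 8 - x ^ 8) / 8 := by
  have hder : ∀ t ∈ Set.uIcc x y, HasDerivAt
      (fun t => a * t + b * t ^ 2 / 2 + c * t ^ 3 / 3 + d * t ^ 4 / 4 + e * t ^ 5 / 5 +
        f * t ^ 6 / 6 + g * t ^ 7 / 7 + h * t ^ 8 / 8)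
      (a + b * t + c * t ^ 2 + d * t ^ 3 + e * t ^ 4 + f * t ^ 5 + g * t ^ 6 + h * t ^ 7) t := by
    intro t _
    have hp := fun n : ℕ => hasDerivAt_pow n t
    refine HasDerivAt.congr_deriv ((((((((hasDerivAt_id t).const_mul a).add
      (((hp 2).const_mul b).div_const 2)).add (((hp 3).const_mul c).div_const 3)).add
      (((hp 4).const_mul d).div_const 4)).add (((hp 5).const_mul e).div_const 5)).add
      (((hp 6).const_mul f).div_const 6)).add (((hp 7).const_mul g).div_const 7) |>.add
      (((hp 8).const_mul h).div_const 8)) ?_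
    norm_num
    ring
  rw [intervalIntegral.integral_eq_sub_of_hasDerivAt hder
    (Continuous.intervalIntegrable (by fun_prop) _ _)]
  ring

lemma integral_baseTriangle_even {h : ℝ × ℝ → ℝ} (hh : Continuous h) {a c e g : ℝ → ℝ}
    (hac : ∀ z, h z = a z.1 + c z.1 * z.2 ^ 2 + e z.1 * z.2 ^ 4 + g z.1 * z.2 ^ 6) :
    ∫ z in baseTriangle, h z = ∫ v in (0 : ℝ)..1, (2 * a v * (1 - v) + 2 / 3 * c v * (1 - v) ^ 3 +
      2 / 5 * e v * (1 - v) ^ 5 + 2 / 7 * g v * (1 - v) ^ 7) := by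
  rw [integral_baseTriangle hh]
  congr 1 with v
  have hp := integral_polynomial (a v) 0 (c v) 0 (e v) 0 (g v) 0 (-(1 - v)) (1 - v)
  refine Eq.trans (intervalIntegral.integral_congr fun w _ => ?_) (hp.trans (by ring))
  simp only [hac]
  ring

lemma integral_baseTriangle_one : ∫ _ in baseTriangle, (1 : ℝ) = 1 := by
  rw [integral_baseTriangle_even continuous_const (a := fun _ => 1) (c := fun _ => 0)
    (e := fun _ => 0) (g := fun _ => 0) (fun _ => by ring)]
  refine Eq.trans (intervalIntegral.integral_congr fun v _ => ?_)
    ((integral_polynomial 2 (-2) 0 0 0 0 0 0 0 1).trans (by norm_num))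
  ring

/-- The symmetric quadratic form detecting `e2`. -/
def momentTwo (y : E3) : ℝ := y 0 ^ 2 + y 1 ^ 2 + y 2 ^ 2

/-- The symmetric cubic form detecting `e3`. -/
def momentThree (y : E3) : ℝ := y 0 * y 1 * y 2

/-- The symmetric quartic form detecting `e4`. -/
def momentFour (y : E3) : ℝ :=
  y 0 ^ 4 + y 1 ^ 4 + y 2 ^ 4 - 3 * (y 0 ^ 2 * y 1 ^ 2 + y 1 ^ 2 * y 2 ^ 2 + y 2 ^ 2 * y 0 ^ 2)

/-- The symmetric sextic form detecting `e6`. -/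
def momentSix (y : E3) : ℝ :=
  2 * (y 0 ^ 6 + y 1 ^ 6 + y 2 ^ 6) -
    15 * (y 0 ^ 4 * y 1 ^ 2 + y 1 ^ 4 * y 0 ^ 2 + y 1 ^ 4 * y 2 ^ 2 + y 2 ^ 4 * y 1 ^ 2 +
      y 2 ^ 4 * y 0 ^ 2 + y 0 ^ 4 * y 2 ^ 2) + 180 * (y 0 ^ 2 * y 1 ^ 2 * y 2 ^ 2)

lemma continuous_momentTwo : Continuous momentTwo := by unfold momentTwo; fun_prop

lemma continuous_momentThree : Continuous momentThree := by unfold momentThree; fun_prop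

lemma continuous_momentFour : Continuous momentFour := by unfold momentFour; fun_prop

lemma continuous_momentSix : Continuous momentSix := by unfold momentSix; fun_prop

lemma eq_of_perm_fin_three {P : Fin 3 → Fin 3 → Fin 3 → Prop}
    (h : P 0 1 2 ∧ P 0 2 1 ∧ P 1 0 2 ∧ P 1 2 0 ∧ P 2 0 1 ∧ P 2 1 0) (σ : Equiv.Perm (Fin 3)) :
    P (σ 0) (σ 1) (σ 2) := by
  have key : ∀ σ : Equiv.Perm (Fin 3), (σ 0, σ 1, σ 2) ∈
      ({(0, 1, 2), (0, 2, 1), (1, 0, 2), (1, 2, 0), (2, 0, 1), (2, 1, 0)} :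
        Finset (Fin 3 × Fin 3 × Fin 3)) := by decide
  have hσ := key σ
  simp only [Finset.mem_insert, Finset.mem_singleton, Prod.mk.injEq] at hσ
  rcases hσ with ⟨h0, h1, h2⟩ | ⟨h0, h1, h2⟩ | ⟨h0, h1, h2⟩ | ⟨h0, h1, h2⟩ | ⟨h0, h1, h2⟩ |
    ⟨h0, h1, h2⟩ <;> rw [h0, h1, h2] <;> tauto

lemma isTetraInvariant_momentTwo : IsTetraInvariant momentTwo where
  perm σ y := eq_of_perm_fin_three (P := fun i j k => y i ^ 2 + y j ^ 2 + y k ^ 2 = momentTwo y)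
    (by unfold momentTwo; refine ⟨?_, ?_, ?_, ?_, ?_, ?_⟩ <;> ring) σ
  sign i y := by fin_cases i <;> simp [momentTwo]

lemma isTetraInvariant_momentThree : IsTetraInvariant momentThree where
  perm σ y := eq_of_perm_fin_three (P := fun i j k => y i * y j * y k = momentThree y)
    (by unfold momentThree; refine ⟨?_, ?_, ?_, ?_, ?_, ?_⟩ <;> ring) σ
  sign i y := by fin_cases i <;> simp [momentThree]

lemma isTetraInvariant_momentFour : IsTetraInvariant momentFour where
  perm σ y := eq_of_perm_fin_three (P := fun i j k => y i ^ 4 + y j ^ 4 + y k ^ 4 -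
      3 * (y i ^ 2 * y j ^ 2 + y j ^ 2 * y k ^ 2 + y k ^ 2 * y i ^ 2) = momentFour y)
    (by unfold momentFour; refine ⟨?_, ?_, ?_, ?_, ?_, ?_⟩ <;> ring) σ
  sign i y := by fin_cases i <;> simp [momentFour] <;> ring

lemma isTetraInvariant_momentSix : IsTetraInvariant momentSix where
  perm σ y := eq_of_perm_fin_three (P := fun i j k => 2 * (y i ^ 6 + y j ^ 6 + y k ^ 6) -
      15 * (y i ^ 4 * y j ^ 2 + y j ^ 4 * y i ^ 2 + y j ^ 4 * y k ^ 2 + y k ^ 4 * y j ^ 2 +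
        y k ^ 4 * y i ^ 2 + y i ^ 4 * y k ^ 2) + 180 * (y i ^ 2 * y j ^ 2 * y k ^ 2) = momentSix y)
    (by unfold momentSix; refine ⟨?_, ?_, ?_, ?_, ?_, ?_⟩ <;> ring) σ
  sign i y := by fin_cases i <;> simp [momentSix] <;> ring

lemma integral_momentTwo (r : ℝ) : ∫ z in baseTriangle, momentTwo (faceMap r z) =
    5 / 6 + 1 / 3 * (r / 3) + 1 / 2 * (r / 3) ^ 2 := by
  rw [integral_baseTriangle_even (h := fun z => momentTwo (faceMap r z))
    (continuous_momentTwo.comp (continuous_faceMap r))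
    (a := fun v => 2 * (r / 3 * v) ^ 2 + (-1 + (1 - r / 3) * v) ^ 2) (c := fun _ => 2)
    (e := fun _ => 0) (g := fun _ => 0) (fun z => by simp [momentTwo, faceMap_eq]; ring)]
  generalize r / 3 = ρ
  refine Eq.trans (intervalIntegral.integral_congr fun v _ => ?_)
    ((integral_polynomial (10 / 3) (-10 + 4 * ρ) (10 - 8 * ρ + 6 * ρ ^ 2)
      (-10 / 3 + 4 * ρ - 6 * ρ ^ 2) 0 0 0 0 0 1).trans (by ring))
  ring

lemma integral_momentThree (r : ℝ) : ∫ z in baseTriangle, momentThree (faceMap r z) =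
    (1 - r / 3) * (3 * (r / 3) ^ 2 + 5 * (r / 3) + 4) / 30 := by
  rw [integral_baseTriangle_even (h := fun z => momentThree (faceMap r z))
    (continuous_momentThree.comp (continuous_faceMap r))
    (a := fun v => (r / 3 * v) ^ 2 * (-1 + (1 - r / 3) * v))
    (c := fun v => -(-1 + (1 - r / 3) * v))
    (e := fun _ => 0) (g := fun _ => 0) (fun z => by simp [momentThree, faceMap_eq]; ring)]
  generalize r / 3 = ρ
  refine Eq.trans (intervalIntegral.integral_congr fun v _ => ?_)
    ((integral_polynomial (2 / 3) (-8 / 3 + 2 / 3 * ρ) (4 - 2 * ρ - 2 * ρ ^ 2)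
      (-8 / 3 + 2 * ρ + 4 * ρ ^ 2 - 2 * ρ ^ 3) (2 / 3 - 2 / 3 * ρ - 2 * ρ ^ 2 + 2 * ρ ^ 3)
      0 0 0 0 1).trans (by ring))
  ring

lemma integral_momentFour (r : ℝ) : ∫ z in baseTriangle, momentFour (faceMap r z) =
    -2 / 5 + 2 / 15 * (r / 3) ^ 2 - 4 / 15 * (r / 3) ^ 3 - 2 / 5 * (r / 3) ^ 4 := by
  rw [integral_baseTriangle_even (h := fun z => momentFour (faceMap r z))
    (continuous_momentFour.comp (continuous_faceMap r))
    (a := fun v => -(r / 3 * v) ^ 4 + (-1 + (1 - r / 3) * v) ^ 4 -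
      6 * (-1 + (1 - r / 3) * v) ^ 2 * (r / 3 * v) ^ 2)
    (c := fun v => 18 * (r / 3 * v) ^ 2 - 6 * (-1 + (1 - r / 3) * v) ^ 2)
    (e := fun _ => -1) (g := fun _ => 0) (fun z => by simp [momentFour, faceMap_eq]; ring)]
  generalize r / 3 = ρ
  refine Eq.trans (intervalIntegral.integral_congr fun v _ => ?_)
    ((integral_polynomial (-12 / 5) 12 (-24 + 8 * ρ ^ 2) (24 - 24 * ρ ^ 2 - 16 * ρ ^ 3)
      (-12 + 24 * ρ ^ 2 + 32 * ρ ^ 3 - 12 * ρ ^ 4)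
      (12 / 5 - 8 * ρ ^ 2 - 16 * ρ ^ 3 + 12 * ρ ^ 4) 0 0 0 1).trans (by ring))
  ring

lemma integral_momentSix_three : ∫ z in baseTriangle, momentSix (faceMap 3 z) = 32 / 7 := by
  rw [integral_baseTriangle_even (h := fun z => momentSix (faceMap 3 z))
    (continuous_momentSix.comp (continuous_faceMap 3))
    (a := fun v => -26 * v ^ 6 + 150 * v ^ 4 - 30 * v ^ 2 + 2)
    (c := fun v => 90 * v ^ 4 - 540 * v ^ 2 - 30)
    (e := fun v => 90 * v ^ 2 + 150) (g := fun _ => -26)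
    (fun z => by simp [momentSix, faceMap_eq]; ring)]
  refine Eq.trans (intervalIntegral.integral_congr fun v _ => ?_)
    ((integral_polynomial (256 / 7) (-192) 0 640 (-320) (-384) 256 (-256 / 7) 0 1).trans
      (by norm_num))
  ring

lemma integral_faceMeasure_ne_zero {r : ℝ} (hr : 0 < r) {h : E3 → ℝ} (hh : Continuous h)
    (hinv : IsTetraInvariant h) (hne : ∫ z in baseTriangle, h (faceMap r z) ≠ 0) :
    ∫ y, h y ∂faceMeasure r ≠ 0 := by
  obtain ⟨κ, hκ, hint⟩ := exists_integral_faceMeasure hr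
  rw [hint h hh hinv]
  exact mul_ne_zero hκ.ne' hne

lemma faceMeasure_real_univ_ne_zero {r : ℝ} (hr : 0 < r) : (faceMeasure r).real Set.univ ≠ 0 := by
  have h := integral_faceMeasure_ne_zero hr (h := fun _ => 1) continuous_const
    ⟨fun _ _ => rfl, fun _ _ => rfl⟩ (by rw [integral_baseTriangle_one]; exact one_ne_zero)
  simpa using h

lemma integral_faceMeasure_momentTwo_ne_zero {r : ℝ} (hr : 0 < r) :
    ∫ y, momentTwo y ∂faceMeasure r ≠ 0 :=
  integral_faceMeasure_ne_zero hr continuous_momentTwo isTetraInvariant_momentTwo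
    (by rw [integral_momentTwo]; positivity)

lemma integral_faceMeasure_momentThree_ne_zero {r : ℝ} (hr : 0 < r) (h3 : r ≠ 3) :
    ∫ y, momentThree y ∂faceMeasure r ≠ 0 := by
  refine integral_faceMeasure_ne_zero hr continuous_momentThree isTetraInvariant_momentThree ?_
  rw [integral_momentThree]
  have h : 1 - r / 3 ≠ 0 := fun h => h3 (by linarith)
  have h' : 3 * (r / 3) ^ 2 + 5 * (r / 3) + 4 ≠ 0 := by positivity
  exact div_ne_zero (mul_ne_zero h h') (by norm_num)

lemma integral_faceMeasure_momentFour_ne_zero {r : ℝ} (hr : 0 < r) :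
    ∫ y, momentFour y ∂faceMeasure r ≠ 0 := by
  refine integral_faceMeasure_ne_zero hr continuous_momentFour isTetraInvariant_momentFour ?_
  rw [integral_momentFour]
  have h : 0 < r / 3 := by positivity
  refine ne_of_lt ?_
  nlinarith [sq_nonneg ((r / 3) ^ 2 - 1), pow_pos h 3, sq_nonneg (r / 3)]

lemma integral_faceMeasure_momentSix_ne_zero : ∫ y, momentSix y ∂faceMeasure 3 ≠ 0 :=
  integral_faceMeasure_ne_zero three_pos continuous_momentSix isTetraInvariant_momentSix
    (by rw [integral_momentSix_three]; norm_num)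

end Coefficients

theorem triakisTetrahedron_face_harmonics
    (r : ℝ) (hr : 0 < r) (f : E3 → ℝ) (hf : Continuous f) :
    (∀ (x : E3) (s : ℝ), 0 < s →
        f x = (∫ y in faceSet r, f (x + s • y) ∂(μH[2])) / (μH[2] (faceSet r)).toReal) ↔
      ((r = 3 → ∃ p : MvPolynomial (Fin 3) ℝ,
          dop e2 p = 0 ∧ dop e4 p = 0 ∧ dop e6 p = 0 ∧ ∀ x, f x = eval (toFn x) p) ∧
       (r ≠ 3 → ∃ p : MvPolynomial (Fin 3) ℝ,
          dop e2 p = 0 ∧ dop e3 p = 0 ∧ dop e4 p = 0 ∧ ∀ x, f x = eval (toFn x) p)) := by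
  have hfin := isFiniteMeasure_faceMeasure hr
  have hτ := isTetrahedral_faceMeasure hr
  have hK := isCompact_faceSet r
  have hreal : (faceMeasure r).real Set.univ = (μH[2] (faceSet r)).toReal := by
    simp [faceMeasure, Measure.real]
  have hne : (μH[2] (faceSet r)).toReal ≠ 0 := hreal ▸ faceMeasure_real_univ_ne_zero hr
  have hmean : (∀ (x : E3) (s : ℝ), 0 < s →
      f x = (∫ y in faceSet r, f (x + s • y) ∂(μH[2])) / (μH[2] (faceSet r)).toReal) ↔
      ∀ x, ∀ s : ℝ, 0 < s →
        ∫ y, f (x + s • y) ∂faceMeasure r = (faceMeasure r).real Set.univ * f x := by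
    refine forall₃_congr fun x s _ => ?_
    rw [hreal, eq_div_iff hne, mul_comm, eq_comm]
    rfl
  rw [hmean]
  by_cases h3 : r = 3
  · subst h3
    simp only [ne_eq, not_true_eq_false, false_imp_iff, and_true, true_imp_iff]
    refine hτ.mean_value_iff_exists_polynomial hK (ae_faceMeasure_mem 3) (fun g hg => ?_)
      (fun I h2 h4 h6 => ⟨h2, h4, h6⟩) (Or.inr fun h _ => integral_faceMeasure_three_neg h) hf
    have h2 := hτ.smoothOp_e2 hg (integral_faceMeasure_momentTwo_ne_zero hr)
    exact ⟨h2, hτ.smoothOp_e4 hg h2 (integral_faceMeasure_momentFour_ne_zero hr),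
      hτ.smoothOp_e6 hg h2 integral_faceMeasure_momentSix_ne_zero⟩
  · simp only [h3, ne_eq, not_false_eq_true, false_imp_iff, true_and, true_imp_iff]
    refine hτ.mean_value_iff_exists_polynomial hK (ae_faceMeasure_mem r) (fun g hg => ?_)
      (fun I h2 h3 h4 => ⟨h2, h4, ?_⟩) (Or.inl rfl) hf
    · have h2 := hτ.smoothOp_e2 hg (integral_faceMeasure_momentTwo_ne_zero hr)
      exact ⟨h2, hτ.smoothOp_e3 hg (integral_faceMeasure_momentThree_ne_zero hr h3),
        hτ.smoothOp_e4 hg h2 (integral_faceMeasure_momentFour_ne_zero hr)⟩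
    · have : e6 = e3 * e3 := by rw [e6, e3]; ring
      rw [this]
      exact I.mul_mem_left _ h3
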